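/- Fix c > 0 and η ∈ [0,1) with c < c̄(η), let ζ = ζ(c,η), and set q_n = √( W(2ζc²) / (2ζ) ) · n^{-1/2}. Let p : ℕ → (0,1) be any sequence with √n·p(n) → c. Then for every ε > 0, the series Σ_{n≥1} P_{p(n)}( ‖A_G − q_n·J‖_□ ≥ ε·q_n·n² | X ≤ η·E X ) converges (in particular, these conditional probabilities tend to 0, so with probability 1 a sequence of independent conditioned samples satisfies ‖A_G − q_n·J‖_□ / (q_n·n²) → 0). -/

import Mathlib

open Filter
open scoped BigOperators symmDiff Classical

noncomputable section

/-- Number of edges of a labeled simple graph on `Fin n`. -/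
def edgeCount {n : ℕ} (G : SimpleGraph (Fin n)) : ℕ := Nat.card G.edgeSet

/-- Number of triangles of a labeled simple graph on `Fin n`. -/
def triCount {n : ℕ} (G : SimpleGraph (Fin n)) : ℕ :=
  Nat.card {s : Finset (Fin n) // G.IsNClique 3 s}

/-- Probability of the event `A` under the Erdős–Rényi random graph `G(n,p)`. -/
def erProb (n : ℕ) (p : ℝ) (A : Set (SimpleGraph (Fin n))) : ℝ :=
  ∑ G : SimpleGraph (Fin n),
    if G ∈ A then p ^ edgeCount G * (1 - p) ^ (n.choose 2 - edgeCount G) else 0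

/-- Conditional probability `P_p(A | B)` for `G(n,p)`. -/
def erCondProb (n : ℕ) (p : ℝ) (A B : Set (SimpleGraph (Fin n))) : ℝ :=
  erProb n p (A ∩ B) / erProb n p B

/-- Probability of the event `A` under the uniform random graph `G(n,m)`. -/
def gnmProb (n m : ℕ) (A : Set (SimpleGraph (Fin n))) : ℝ :=
  (Nat.card {G : SimpleGraph (Fin n) // edgeCount G = m ∧ G ∈ A} : ℝ) /
    ((n.choose 2).choose m : ℝ)

/-- Expected number of triangles of `G(n,m)`. -/
def gnmExpTri (n m : ℕ) : ℝ :=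
  (∑ G : SimpleGraph (Fin n), if edgeCount G = m then (triCount G : ℝ) else 0) /
    ((n.choose 2).choose m : ℝ)

/-- Gibbs weight `λ^{|G|} (1-ζ)^{X(G)}`. -/
def gibbsWeight {n : ℕ} (lam zeta : ℝ) (G : SimpleGraph (Fin n)) : ℝ :=
  lam ^ edgeCount G * (1 - zeta) ^ triCount G

/-- The partition function `Z(λ,ζ)`. -/
def Zfun (n : ℕ) (lam zeta : ℝ) : ℝ := ∑ G : SimpleGraph (Fin n), gibbsWeight lam zeta G

/-- Probability of the event `A` under the Gibbs measure `μ_{λ,ζ}`. -/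
def gibbsProb (n : ℕ) (lam zeta : ℝ) (A : Set (SimpleGraph (Fin n))) : ℝ :=
  (∑ G : SimpleGraph (Fin n), if G ∈ A then gibbsWeight lam zeta G else 0) / Zfun n lam zeta

/-- Expectation of `f` under the Gibbs measure `μ_{λ,ζ}`. -/
def gibbsExp (n : ℕ) (lam zeta : ℝ) (f : SimpleGraph (Fin n) → ℝ) : ℝ :=
  (∑ G : SimpleGraph (Fin n), f G * gibbsWeight lam zeta G) / Zfun n lam zeta

/-- Number of edges of `H` with both endpoints in `S`. -/
def edgesIn {V : Type*} (H : SimpleGraph V) (S : Finset V) : ℕ :=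
  Nat.card {e : Sym2 V // e ∈ H.edgeSet ∧ ∀ v ∈ e, v ∈ S}

/-- Weight `λ^{|S|} (1-ζ)^{|E(S)|}` of the measure `ν_{H,λ,ζ}`. -/
def nuWeight {V : Type*} (H : SimpleGraph V) (lam zeta : ℝ) (S : Finset V) : ℝ :=
  lam ^ S.card * (1 - zeta) ^ edgesIn H S

/-- The partition function `Ξ_H(λ,ζ)`. -/
def XiFun {V : Type*} [Fintype V] (H : SimpleGraph V) (lam zeta : ℝ) : ℝ :=
  ∑ S : Finset V, nuWeight H lam zeta S

/-- The probability of `S` under `ν_{H,λ,ζ}`. -/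
def nuProb {V : Type*} [Fintype V] (H : SimpleGraph V) (lam zeta : ℝ) (S : Finset V) : ℝ :=
  nuWeight H lam zeta S / XiFun H lam zeta

/-- `W` is the Lambert-W function on `[0,∞)`: for `x ≥ 0`, `W x` is the unique `w ≥ 0`
with `w·e^w = x`. -/
def IsLambertW (W : ℝ → ℝ) : Prop :=
  ∀ x : ℝ, 0 ≤ x → (0 ≤ W x ∧ W x * Real.exp (W x) = x ∧
    ∀ w : ℝ, 0 ≤ w → w * Real.exp w = x → w = W x)

/-- `η* = (W(2/e)/(2/e))^{3/2}`. -/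
def etaStar (W : ℝ → ℝ) : ℝ := (W (2 / Real.exp 1) / (2 / Real.exp 1)) ^ ((3 : ℝ) / 2)

/-- The condition `c < c̄(η)` where `c̄(η) = 1/√(e(1−η/η*))` for `η < η*` and `+∞` otherwise. -/
def LtCbar (W : ℝ → ℝ) (c η : ℝ) : Prop :=
  η < etaStar W → c < 1 / Real.sqrt (Real.exp 1 * (1 - η / etaStar W))

/-- The left-hand side of the equation defining `ζ(c,η)`, interpreted as `1` at `ζ = 0`. -/
def zetaLHS (W : ℝ → ℝ) (c zeta : ℝ) : ℝ :=
  (1 - zeta) * (if zeta = 0 then 1 else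
    (W (2 * zeta * c ^ 2) / (2 * zeta * c ^ 2)) ^ ((3 : ℝ) / 2))



/-- The cut norm `‖A‖_□ = max_{x,y ∈ {0,1}^n} xᵀ A y` of an `n × n` real matrix. -/
def cutNorm {n : ℕ} (A : Matrix (Fin n) (Fin n) ℝ) : ℝ :=
  ⨆ x : Fin n → Bool, ⨆ y : Fin n → Bool,
    ∑ i : Fin n, ∑ j : Fin n,
      (if x i then (1 : ℝ) else 0) * A i j * (if y j then (1 : ℝ) else 0)

/-- The adjacency matrix of a graph, with real entries. -/
def adjMat {n : ℕ} (G : SimpleGraph (Fin n)) : Matrix (Fin n) (Fin n) ℝ :=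
  fun i j => if G.Adj i j then 1 else 0

set_option linter.unusedSectionVars false

section Hypergraph

variable {V ι : Type*} [Fintype V] [DecidableEq V] [DecidableEq ι]

/-- Weight of `S` in the lattice gas with activities `lam` and soft constraints `t i ⊆ S ∪ P`,
`i ∈ J`, each of which costs a factor `1 - z i`. The sites in `P` are pinned. -/
def gasWeight (t : ι → Finset V) (lam : V → ℝ) (z : ι → ℝ) (P : Finset V) (J : Finset ι)
    (S : Finset V) : ℝ :=
  (∏ v ∈ S, lam v) * ∏ i ∈ J, if t i ⊆ S ∪ P then 1 - z i else 1

/-- Partition function of the lattice gas on the complement of `P`. -/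
def gasZ (t : ι → Finset V) (lam : V → ℝ) (z : ι → ℝ) (P : Finset V) (J : Finset ι) : ℝ :=
  ∑ S ∈ Pᶜ.powerset, gasWeight t lam z P J S

/-- The part of the partition function in which the constraint `i` is active. -/
def gasSat (t : ι → Finset V) (lam : V → ℝ) (z : ι → ℝ) (P : Finset V) (J : Finset ι)
    (i : ι) : ℝ :=
  ∑ S ∈ Pᶜ.powerset, if t i ⊆ S ∪ P then gasWeight t lam z P J S else 0

variable {t : ι → Finset V} {lam : V → ℝ} {z : ι → ℝ}

lemma compl_eq_insert_compl_insert {v : V} {P : Finset V} (hv : v ∉ P) :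
    Pᶜ = insert v (insert v P)ᶜ := by
  ext x; simp only [Finset.mem_compl, Finset.mem_insert, not_or]
  by_cases h : x = v
  · subst h; simp [hv]
  · simp [h]

lemma gasWeight_insert {v : V} {P S : Finset V} (hS : v ∉ S) (J : Finset ι) :
    gasWeight t lam z P J (insert v S) = lam v * gasWeight t lam z (insert v P) J S := by
  have h : insert v S ∪ P = S ∪ insert v P := by ext; simp
  simp [gasWeight, Finset.prod_insert hS, h, mul_assoc]

lemma gasZ_split {v : V} {P : Finset V} (hv : v ∉ P) (J : Finset ι) :
    gasZ t lam z P J = gasZ t lam z (insert v P) (J.filter (fun i => v ∉ t i)) +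
      lam v * gasZ t lam z (insert v P) J := by
  have hv' : v ∉ (insert v P)ᶜ := by simp
  unfold gasZ
  rw [compl_eq_insert_compl_insert hv, Finset.sum_powerset_insert hv', Finset.mul_sum]
  have hS : ∀ S ∈ ((insert v P)ᶜ).powerset, v ∉ S := fun S hS h =>
    hv' (Finset.mem_powerset.1 hS h)
  congr 1
  · refine Finset.sum_congr rfl fun S hSm => ?_
    unfold gasWeight
    rw [Finset.prod_filter]
    congr 1
    refine Finset.prod_congr rfl fun i _ => ?_
    by_cases hi : v ∈ t i
    · have : ¬ t i ⊆ S ∪ P := fun h => by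
        have := h hi
        simp [hS S hSm, hv] at this
      simp [hi, this]
    · have : t i ⊆ S ∪ P ↔ t i ⊆ S ∪ insert v P := by
        constructor
        · intro h x hx; have := h hx; simp at this ⊢; tauto
        · intro h x hx
          have h1 := h hx
          have : x ≠ v := fun e => hi (e ▸ hx)
          simp at h1 ⊢; tauto
      simp [hi, this]
  · exact Finset.sum_congr rfl fun S hSm => gasWeight_insert (hS S hSm) J

lemma gasSat_insert {v : V} {P : Finset V} (hv : v ∉ P) (J : Finset ι) {i : ι} (hi : v ∈ t i) :
    gasSat t lam z P J i = lam v * gasSat t lam z (insert v P) J i := by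
  have hv' : v ∉ (insert v P)ᶜ := by simp
  unfold gasSat
  rw [compl_eq_insert_compl_insert hv, Finset.sum_powerset_insert hv', Finset.mul_sum]
  have hS : ∀ S ∈ ((insert v P)ᶜ).powerset, v ∉ S := fun S hS h =>
    hv' (Finset.mem_powerset.1 hS h)
  rw [Finset.sum_eq_zero, zero_add]
  · refine Finset.sum_congr rfl fun S hSm => ?_
    have h : insert v S ∪ P = S ∪ insert v P := by ext; simp
    rw [h, gasWeight_insert (hS S hSm) J, mul_ite, mul_zero]
  · intro S hSm
    rw [if_neg]
    intro h
    have := h hi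
    simp [hS S hSm, hv] at this

lemma gasSat_of_subset {P : Finset V} (J : Finset ι) {i : ι} (hi : t i ⊆ P) :
    gasSat t lam z P J i = gasZ t lam z P J := by
  unfold gasSat gasZ
  refine Finset.sum_congr rfl fun S _ => ?_
  rw [if_pos (hi.trans Finset.subset_union_right)]

lemma gasZ_insert_constraint (P : Finset V) {J : Finset ι} {i : ι} (hi : i ∉ J) :
    gasZ t lam z P (insert i J) = gasZ t lam z P J - z i * gasSat t lam z P J i := by
  unfold gasZ gasSat
  rw [Finset.mul_sum, ← Finset.sum_sub_distrib]
  refine Finset.sum_congr rfl fun S _ => ?_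
  unfold gasWeight
  rw [Finset.prod_insert hi]
  split_ifs <;> ring

lemma gasWeight_nonneg (hl : ∀ v, 0 ≤ lam v) (hz : ∀ i, z i ≤ 1) (P : Finset V) (J : Finset ι)
    (S : Finset V) : 0 ≤ gasWeight t lam z P J S := by
  refine mul_nonneg (Finset.prod_nonneg fun v _ => hl v) (Finset.prod_nonneg fun i _ => ?_)
  split_ifs
  · linarith [hz i]
  · exact zero_le_one

lemma gasZ_nonneg (hl : ∀ v, 0 ≤ lam v) (hz : ∀ i, z i ≤ 1) (P : Finset V) (J : Finset ι) :
    0 ≤ gasZ t lam z P J :=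
  Finset.sum_nonneg fun _ _ => gasWeight_nonneg hl hz _ _ _

lemma gasSat_nonneg (hl : ∀ v, 0 ≤ lam v) (hz : ∀ i, z i ≤ 1) (P : Finset V) (J : Finset ι)
    (i : ι) : 0 ≤ gasSat t lam z P J i := by
  refine Finset.sum_nonneg fun _ _ => ?_
  split_ifs
  · exact gasWeight_nonneg hl hz _ _ _
  · exact le_rfl

lemma gasZ_antitone (hl : ∀ v, 0 ≤ lam v) (hz0 : ∀ i, 0 ≤ z i) (hz : ∀ i, z i ≤ 1) (P : Finset V)
    {J J' : Finset ι} (h : J ⊆ J') : gasZ t lam z P J' ≤ gasZ t lam z P J := by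
  refine Finset.sum_le_sum fun S _ => ?_
  refine mul_le_mul_of_nonneg_left ?_ (Finset.prod_nonneg fun v _ => hl v)
  refine Finset.prod_le_prod_of_subset_of_le_one h (fun i _ => ?_) (fun i _ _ => ?_)
  · split_ifs
    · linarith [hz i]
    · exact zero_le_one
  · split_ifs
    · linarith [hz0 i]
    · exact le_rfl

/-- Uniform upper bound for the odds of an unpinned site, over all configurations with at most
`j` pinned sites. -/
def OddsLE (t : ι → Finset V) (lam : V → ℝ) (z : ι → ℝ) (j : ℕ) (M : ℝ) : Prop :=
  ∀ (P : Finset V) (J : Finset ι), P.card ≤ j → (∀ i, Disjoint (t i) P → i ∈ J) → ∀ v ∉ P,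
    lam v * gasZ t lam z (insert v P) J ≤
      M * gasZ t lam z (insert v P) (J.filter (fun i => v ∉ t i))

/-- Uniform lower bound for the odds of an unpinned site that is not the last site of some
constraint, over all configurations with at most `j` pinned sites. -/
def OddsGE (t : ι → Finset V) (lam : V → ℝ) (z : ι → ℝ) (j : ℕ) (m : ℝ) : Prop :=
  ∀ (P : Finset V) (J : Finset ι), P.card ≤ j → (∀ i, Disjoint (t i) P → i ∈ J) → ∀ v ∉ P,
    (∀ i ∈ J, v ∈ t i → ¬ t i ⊆ insert v P) →
    m * gasZ t lam z (insert v P) (J.filter (fun i => v ∉ t i)) ≤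
      lam v * gasZ t lam z (insert v P) J

lemma OddsLE.occ {j : ℕ} {M : ℝ} (h : OddsLE t lam z j M) (hM : 0 ≤ M)
    (hl : ∀ v, 0 ≤ lam v) (hz : ∀ i, z i ≤ 1) {P : Finset V} {J : Finset ι} (hP : P.card ≤ j)
    (hJ : ∀ i, Disjoint (t i) P → i ∈ J) {v : V} (hv : v ∉ P) :
    lam v * gasZ t lam z (insert v P) J ≤ M * gasZ t lam z P J := by
  refine (h P J hP hJ v hv).trans (mul_le_mul_of_nonneg_left ?_ hM)
  rw [gasZ_split hv]
  have := mul_nonneg (hl v) (gasZ_nonneg hl hz (t := t) (insert v P) J)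
  linarith

lemma OddsGE.occ {j : ℕ} {m : ℝ} (h : OddsGE t lam z j m) (hm : 0 ≤ m)
    {P : Finset V} {J : Finset ι} (hP : P.card ≤ j)
    (hJ : ∀ i, Disjoint (t i) P → i ∈ J) {v : V} (hv : v ∉ P)
    (hgood : ∀ i ∈ J, v ∈ t i → ¬ t i ⊆ insert v P) :
    m / (1 + m) * gasZ t lam z P J ≤ lam v * gasZ t lam z (insert v P) J := by
  have h1 := h P J hP hJ v hv hgood
  have h2 := gasZ_split (t := t) (lam := lam) (z := z) hv J
  rw [div_mul_eq_mul_div, div_le_iff₀ (by linarith), h2]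
  linarith

/-- Adding constraints each of which is active with conditional probability at least `θ`. -/
lemma gasZ_union_le {P : Finset V} {J₀ G : Finset ι} (hd : Disjoint J₀ G) {ζ θ : ℝ}
    (hl : ∀ v, 0 ≤ lam v) (hz : ∀ i, z i ≤ 1) (hζ : 0 ≤ ζ) (hζz : ∀ i, ζ ≤ z i)
    (hζθ : ζ * θ ≤ 1)
    (h : ∀ i ∈ G, ∀ J, J₀ ⊆ J → J ⊆ J₀ ∪ G → i ∉ J → θ * gasZ t lam z P J ≤ gasSat t lam z P J i) :
    gasZ t lam z P (J₀ ∪ G) ≤ (1 - ζ * θ) ^ G.card * gasZ t lam z P J₀ := by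
  induction G using Finset.induction_on with
  | empty => simp
  | insert i G hi ih =>
    have hiJ : i ∉ J₀ := fun hc => Finset.disjoint_left.1 hd hc (Finset.mem_insert_self _ _)
    have hiU : i ∉ J₀ ∪ G := by simp [hi, hiJ]
    have ih' := ih (hd.mono_right (Finset.subset_insert _ _))
      (fun k hk J h1 h2 h3 => h k (Finset.mem_insert_of_mem hk) J h1
        (h2.trans (Finset.union_subset_union_right (Finset.subset_insert _ _))) h3)
    rw [Finset.union_insert, gasZ_insert_constraint P hiU, Finset.card_insert_of_notMem hi]
    have h1 := h i (Finset.mem_insert_self _ _) (J₀ ∪ G) Finset.subset_union_left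
      (Finset.union_subset_union_right (Finset.subset_insert _ _)) hiU
    have h2 := mul_le_mul_of_nonneg_left h1 hζ
    have h3 := mul_le_mul_of_nonneg_right (hζz i) (gasSat_nonneg hl hz (t := t) P (J₀ ∪ G) i)
    have h4 := mul_le_mul_of_nonneg_left ih' (sub_nonneg.2 hζθ)
    rw [pow_succ']
    nlinarith

/-- Adding constraints each of which is active with conditional probability at most `f i`. -/
lemma le_gasZ_union {P : Finset V} {J₀ G : Finset ι} (hd : Disjoint J₀ G) {f : ι → ℝ}
    (hf1 : ∀ i ∈ G, f i ≤ 1)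
    (h : ∀ i ∈ G, ∀ J, J₀ ⊆ J → J ⊆ J₀ ∪ G → i ∉ J →
      z i * gasSat t lam z P J i ≤ f i * gasZ t lam z P J) :
    (∏ i ∈ G, (1 - f i)) * gasZ t lam z P J₀ ≤ gasZ t lam z P (J₀ ∪ G) := by
  induction G using Finset.induction_on with
  | empty => simp
  | insert i G hi ih =>
    have hiJ : i ∉ J₀ := fun hc => Finset.disjoint_left.1 hd hc (Finset.mem_insert_self _ _)
    have hiU : i ∉ J₀ ∪ G := by simp [hi, hiJ]
    have ih' := ih (hd.mono_right (Finset.subset_insert _ _))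
      (fun k hk => hf1 k (Finset.mem_insert_of_mem hk))
      (fun k hk J h1 h2 h3 => h k (Finset.mem_insert_of_mem hk) J h1
        (h2.trans (Finset.union_subset_union_right (Finset.subset_insert _ _))) h3)
    rw [Finset.union_insert, gasZ_insert_constraint P hiU, Finset.prod_insert hi]
    have h1 := h i (Finset.mem_insert_self _ _) (J₀ ∪ G) Finset.subset_union_left
      (Finset.union_subset_union_right (Finset.subset_insert _ _)) hiU
    have h4 := mul_le_mul_of_nonneg_left ih' (sub_nonneg.2 (hf1 i (Finset.mem_insert_self _ _)))
    nlinarith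

/-- Any two distinct sites determine the constraint containing them. -/
def IsLinearFamily (t : ι → Finset V) : Prop :=
  ∀ i k a b, a ≠ b → a ∈ t i → b ∈ t i → a ∈ t k → b ∈ t k → i = k

lemma card_filter_meets_le [Fintype ι] (hlin : IsLinearFamily t) {v : V} {Q : Finset V}
    (hv : v ∉ Q) :
    (Finset.univ.filter (fun i => v ∈ t i ∧ ¬ Disjoint (t i) Q)).card ≤ Q.card := by
  have hex : ∀ i, ∃ x, ¬ Disjoint (t i) Q → x ∈ t i ∧ x ∈ Q := fun i => by
    by_cases h : Disjoint (t i) Q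
    · exact ⟨v, fun h' => absurd h h'⟩
    · obtain ⟨x, hx1, hx2⟩ := Finset.not_disjoint_iff.1 h
      exact ⟨x, fun _ => ⟨hx1, hx2⟩⟩
  choose g hg using hex
  refine Finset.card_le_card_of_injOn g (fun i hi => ?_) (fun i hi k hk hik => ?_)
  · simp only [Finset.coe_filter, Finset.mem_univ, true_and, Set.mem_ofPred_eq] at hi
    exact (hg i hi.2).2
  · simp only [Finset.coe_filter, Finset.mem_univ, true_and, Set.mem_ofPred_eq] at hi hk
    have h1 := hg i hi.2
    have h2 := hg k hk.2
    refine hlin i k v (g i) (fun e => hv (e ▸ h1.2)) hi.1 h1.1 hk.1 ?_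
    rw [hik]; exact h2.1

/-- The sites outside `P` that complete a constraint whose other sites are in `P`. -/
def lastSites (t : ι → Finset V) (P : Finset V) : Finset V :=
  Finset.univ.filter (fun a => a ∉ P ∧ ∃ i, a ∈ t i ∧ t i ⊆ insert a P)

lemma mem_lastSites {P : Finset V} {a : V} :
    a ∈ lastSites t P ↔ a ∉ P ∧ ∃ i, a ∈ t i ∧ t i ⊆ insert a P := by
  simp [lastSites]

lemma card_lastSites_le (h3 : ∀ i, (t i).card = 3) (hlin : IsLinearFamily t) (P : Finset V) :
    (lastSites t P).card ≤ P.card ^ 2 := by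
  have hex : ∀ a, ∃ q : V × V, a ∈ lastSites t P → q.1 ∈ P ∧ q.2 ∈ P ∧ q.1 ≠ q.2 ∧
      ∃ i, a ∈ t i ∧ q.1 ∈ t i ∧ q.2 ∈ t i ∧ t i ⊆ insert a P := fun a => by
    by_cases ha : a ∈ lastSites t P
    · obtain ⟨haP, i, hai, hi⟩ := mem_lastSites.1 ha
      have h2 : 1 < ((t i).erase a).card := by rw [Finset.card_erase_of_mem hai, h3]; norm_num
      obtain ⟨x, hx, y, hy, hxy⟩ := Finset.one_lt_card.1 h2
      rw [Finset.mem_erase] at hx hy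
      exact ⟨(x, y), fun _ => ⟨Finset.mem_of_mem_insert_of_ne (hi hx.2) hx.1,
        Finset.mem_of_mem_insert_of_ne (hi hy.2) hy.1, hxy, i, hai, hx.2, hy.2, hi⟩⟩
    · exact ⟨(a, a), fun h => absurd h ha⟩
  choose g hg using hex
  rw [sq, ← Finset.card_product]
  refine Finset.card_le_card_of_injOn g (fun a ha => ?_) (fun a ha b hb hab => ?_)
  · have := hg a ha
    simp [this.1, this.2.1]
  · obtain ⟨h1, h2, hne, i, hai, hxi, hyi, hi⟩ := hg a ha
    obtain ⟨h1', h2', hne', k, hbk, hxk, hyk, hk⟩ := hg b hb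
    rw [← hab] at hxk hyk
    have hik := hlin i k _ _ hne hxi hyi hxk hyk
    subst hik
    have haP := (mem_lastSites.1 ha).1
    exact (Finset.mem_insert.1 (hk hai)).resolve_right haP

lemma exists_triple (h3 : ∀ i, (t i).card = 3) {i : ι} {v : V} (hv : v ∈ t i) :
    ∃ a b, a ≠ b ∧ a ≠ v ∧ b ≠ v ∧ t i = {v, a, b} := by
  have h2 : ((t i).erase v).card = 2 := by rw [Finset.card_erase_of_mem hv, h3]
  obtain ⟨a, b, hab, h⟩ := Finset.card_eq_two.1 h2
  have ha : a ∈ (t i).erase v := by simp [h]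
  have hb : b ∈ (t i).erase v := by simp [h]
  exact ⟨a, b, hab, (Finset.mem_erase.1 ha).1, (Finset.mem_erase.1 hb).1, by
    rw [← Finset.insert_erase hv, h]⟩

lemma gasSat_pair {P : Finset V} (J : Finset ι) {i : ι} {a b : V} (ha : a ∉ P) (hb : b ∉ P)
    (hab : a ≠ b) (hai : a ∈ t i) (hbi : b ∈ t i) (hi : t i ⊆ insert b (insert a P)) :
    gasSat t lam z P J i = lam a * (lam b * gasZ t lam z (insert b (insert a P)) J) := by
  rw [gasSat_insert ha J hai, gasSat_insert (by simp [hb, hab.symm]) J hbi, gasSat_of_subset J hi]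

/-- Lower bounds on the odds imply upper bounds on the odds. -/
lemma OddsGE.oddsLE [Fintype ι] (h3 : ∀ i, (t i).card = 3) (hlin : IsLinearFamily t) {N : ℕ}
    (hN : ∀ v, N ≤ (Finset.univ.filter (fun i => v ∈ t i)).card) {L ζ m : ℝ} {j : ℕ}
    (hl : ∀ v, 0 ≤ lam v) (hlL : ∀ v, lam v ≤ L) (hz : ∀ i, z i ≤ 1) (hζ : 0 ≤ ζ)
    (hζz : ∀ i, ζ ≤ z i) (hm : 0 ≤ m) (h : OddsGE t lam z (j + 2) m) :
    OddsLE t lam z j (L * (1 - ζ * (m / (1 + m)) ^ 2) ^ (N - (j + (j + 1) ^ 2))) := by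
  intro P J hP hJ v hv
  set P' := insert v P with hP'
  set J₀ := J.filter (fun i => v ∉ t i) with hJ₀
  set B := lastSites t P' with hB
  set G := J.filter (fun i => v ∈ t i ∧ Disjoint (t i) (P ∪ B)) with hG
  have hP'c : P'.card ≤ j + 1 := (Finset.card_insert_le _ _).trans (by omega)
  have hBc : B.card ≤ (j + 1) ^ 2 :=
    (card_lastSites_le h3 hlin P').trans (Nat.pow_le_pow_left hP'c 2)
  have hvB : v ∉ P ∪ B := by simp [hv, hB, lastSites, hP']
  have hGc : N - (j + (j + 1) ^ 2) ≤ G.card := by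
    have h1 : Finset.univ.filter (fun i => v ∈ t i) ⊆
        G ∪ Finset.univ.filter (fun i => v ∈ t i ∧ ¬ Disjoint (t i) (P ∪ B)) := by
      intro i hi
      simp only [Finset.mem_filter, Finset.mem_univ, true_and, Finset.mem_union, hG] at hi ⊢
      by_cases hd : Disjoint (t i) (P ∪ B)
      · exact Or.inl ⟨hJ i (hd.mono_right Finset.subset_union_left), hi, hd⟩
      · exact Or.inr ⟨hi, hd⟩
    have h2 := (hN v).trans ((Finset.card_le_card h1).trans (Finset.card_union_le _ _))
    have h3' := card_filter_meets_le hlin hvB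
    have h4 := Finset.card_union_le P B
    omega
  have hθ0 : 0 ≤ m / (1 + m) := by positivity
  have hθ1 : m / (1 + m) ≤ 1 := by rw [div_le_one (by linarith)]; linarith
  set θ := (m / (1 + m)) ^ 2 with hθ
  have hθ0' : 0 ≤ θ := by positivity
  have hθ1' : θ ≤ 1 := pow_le_one₀ hθ0 hθ1
  by_cases hne : Nonempty ι
  swap
  · have hJe : ∀ K : Finset ι, K = ∅ := fun K => Finset.eq_empty_of_forall_notMem
      fun i _ => hne ⟨i⟩
    have hN0 : N = 0 := by
      have := hN v
      rw [hJe (Finset.univ.filter (fun i => v ∈ t i))] at this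
      simpa using this
    rw [hJe J₀, hJe J, hN0, Nat.zero_sub, pow_zero, mul_one]
    exact mul_le_mul_of_nonneg_right (hlL v) (gasZ_nonneg hl hz _ _)
  have hζ1 : ζ ≤ 1 := (hζz hne.some).trans (hz _)
  have hζθ : ζ * θ ≤ 1 := mul_le_one₀ hζ1 hθ0' hθ1'
  have hd : Disjoint J₀ G := by
    rw [Finset.disjoint_left]
    intro i hi hi'
    exact (Finset.mem_filter.1 hi).2 (Finset.mem_filter.1 hi').2.1
  have hsub : J₀ ∪ G ⊆ J := Finset.union_subset (Finset.filter_subset _ _) (Finset.filter_subset _ _)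
  have key := gasZ_union_le (t := t) (lam := lam) (z := z) (P := P') hd hl hz hζ hζz hζθ (by
    intro i hi K hK1 hK2 hiK
    obtain ⟨-, hvi, hdi⟩ := Finset.mem_filter.1 hi
    obtain ⟨a, b, hab, hav, hbv, hti⟩ := exists_triple h3 hvi
    have hai : a ∈ t i := by simp [hti]
    have hbi : b ∈ t i := by simp [hti]
    have haPB := Finset.disjoint_left.1 hdi hai
    have hbPB := Finset.disjoint_left.1 hdi hbi
    simp only [Finset.mem_union, not_or] at haPB hbPB
    have haP' : a ∉ P' := by simp [hP', hav, haPB.1]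
    have hbP' : b ∉ P' := by simp [hP', hbv, hbPB.1]
    have hKst : ∀ k, Disjoint (t k) P' → k ∈ K := by
      intro k hk
      rw [hP', Finset.disjoint_insert_right] at hk
      exact hK1 (Finset.mem_filter.2 ⟨hJ k hk.2, hk.1⟩)
    have ha : m / (1 + m) * gasZ t lam z P' K ≤ lam a * gasZ t lam z (insert a P') K := by
      refine h.occ hm (by omega) hKst haP' fun k _ hak hk => haPB.2 ?_
      exact mem_lastSites.2 ⟨haP', k, hak, hk⟩
    have hb : m / (1 + m) * gasZ t lam z (insert a P') K ≤
        lam b * gasZ t lam z (insert b (insert a P')) K := by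
      refine h.occ hm ((Finset.card_insert_le _ _).trans (by omega))
        (fun k hk => hKst k (hk.mono_right (Finset.subset_insert _ _)))
        (by simp [hbP', hab.symm]) fun k hkK hbk hk => ?_
      by_cases hak : a ∈ t k
      · exact hiK (hlin i k a b hab hai hbi hak hbk ▸ hkK)
      · refine hbPB.2 (mem_lastSites.2 ⟨hbP', k, hbk, fun x hx => ?_⟩)
        have h1 := hk hx
        have h2 : x ≠ a := fun e => hak (e ▸ hx)
        simp only [Finset.mem_insert] at h1 ⊢
        tauto
    rw [gasSat_pair K haP' hbP' hab hai hbi (by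
      rw [hti]; intro x hx; simp only [Finset.mem_insert, Finset.mem_singleton, hP'] at hx ⊢; tauto)]
    have h5 := mul_le_mul_of_nonneg_left ha hθ0
    have h6 := mul_le_mul_of_nonneg_left hb (hl a)
    rw [hθ]
    nlinarith)
  have hL : 0 ≤ L := (hl v).trans (hlL v)
  calc lam v * gasZ t lam z P' J ≤ L * gasZ t lam z P' (J₀ ∪ G) :=
        mul_le_mul (hlL v) (gasZ_antitone hl (fun i => hζ.trans (hζz i)) hz _ hsub)
          (gasZ_nonneg hl hz _ _) hL
    _ ≤ L * ((1 - ζ * θ) ^ G.card * gasZ t lam z P' J₀) := mul_le_mul_of_nonneg_left key hL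
    _ ≤ L * ((1 - ζ * θ) ^ (N - (j + (j + 1) ^ 2)) * gasZ t lam z P' J₀) := by
        refine mul_le_mul_of_nonneg_left (mul_le_mul_of_nonneg_right ?_ (gasZ_nonneg hl hz _ _)) hL
        exact pow_le_pow_of_le_one (by linarith) (by nlinarith) hGc
    _ = _ := by ring

/-- Upper bounds on the odds imply lower bounds on the odds. -/
lemma OddsLE.oddsGE [Fintype ι] (h3 : ∀ i, (t i).card = 3) (hlin : IsLinearFamily t) {N : ℕ}
    (hN : ∀ v, (Finset.univ.filter (fun i => v ∈ t i)).card ≤ N) {l ζ M : ℝ} {j : ℕ}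
    (hl0 : 0 ≤ l) (hl : ∀ v, l ≤ lam v) (hz0 : ∀ i, 0 ≤ z i) (hz : ∀ i, z i ≤ 1)
    (hζ : 0 ≤ ζ) (hζz : ∀ i, z i ≤ ζ) (hM0 : 0 ≤ M) (hM1 : M ≤ 1) (hζM : ζ * M ^ 2 ≤ 1)
    (h : OddsLE t lam z (j + 2) M) :
    OddsGE t lam z j (l * ((1 - ζ * M ^ 2) ^ N * (1 - M) ^ j)) := by
  intro P J hP hJ v hv hgood
  set P' := insert v P with hP'
  set J₀ := J.filter (fun i => v ∉ t i) with hJ₀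
  set G := J.filter (fun i => v ∈ t i) with hG
  have hlam : ∀ v, 0 ≤ lam v := fun v => hl0.trans (hl v)
  have hP'c : P'.card ≤ j + 1 := (Finset.card_insert_le _ _).trans (by omega)
  have hd : Disjoint J₀ G := by
    rw [Finset.disjoint_left]
    intro i hi hi'
    exact (Finset.mem_filter.1 hi).2 (Finset.mem_filter.1 hi').2
  have hun : J₀ ∪ G = J := by
    ext i; simp only [hJ₀, hG, Finset.mem_union, Finset.mem_filter]; tauto
  set f : ι → ℝ := fun i => if Disjoint (t i) P then ζ * M ^ 2 else M with hf
  have hf1 : ∀ i ∈ G, f i ≤ 1 := fun i _ => by simp only [hf]; split_ifs <;> assumption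
  have key := le_gasZ_union (t := t) (lam := lam) (z := z) (P := P') hd hf1 (by
    intro i hi K hK1 hK2 hiK
    obtain ⟨hiJ, hvi⟩ := Finset.mem_filter.1 hi
    obtain ⟨a, b, hab, hav, hbv, hti⟩ := exists_triple h3 hvi
    have hai : a ∈ t i := by simp [hti]
    have hbi : b ∈ t i := by simp [hti]
    have hKst : ∀ k, Disjoint (t k) P' → k ∈ K := by
      intro k hk
      rw [hP', Finset.disjoint_insert_right] at hk
      exact hK1 (Finset.mem_filter.2 ⟨hJ k hk.2, hk.1⟩)
    have hZ := gasZ_nonneg hlam hz (t := t) P' K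
    by_cases hdi : Disjoint (t i) P
    · have haP' : a ∉ P' := by simp [hP', hav, Finset.disjoint_left.1 hdi hai]
      have hbP' : b ∉ P' := by simp [hP', hbv, Finset.disjoint_left.1 hdi hbi]
      have ha := h.occ hM0 hlam hz (by omega) hKst haP'
      have hb := h.occ hM0 hlam hz (P := insert a P') ((Finset.card_insert_le _ _).trans (by omega))
        (fun k hk => hKst k (hk.mono_right (Finset.subset_insert _ _)))
        (v := b) (by simp [hbP', hab.symm])
      rw [gasSat_pair K haP' hbP' hab hai hbi (by
        rw [hti]; intro x hx
        simp only [Finset.mem_insert, Finset.mem_singleton, hP'] at hx ⊢; tauto)]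
      simp only [hf, if_pos hdi]
      have h6 := mul_le_mul_of_nonneg_left hb (hlam a)
      have h5 := mul_le_mul_of_nonneg_left ha hM0
      have h7 : lam a * (lam b * gasZ t lam z (insert b (insert a P')) K) ≤
        M ^ 2 * gasZ t lam z P' K := by nlinarith
      calc _ ≤ z i * (M ^ 2 * gasZ t lam z P' K) := mul_le_mul_of_nonneg_left h7 (hz0 i)
        _ ≤ ζ * (M ^ 2 * gasZ t lam z P' K) :=
          mul_le_mul_of_nonneg_right (hζz i) (by positivity)
        _ = _ := by ring
    · have hex : ∃ w ∈ t i, w ∉ P' ∧ t i ⊆ insert w P' := by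
        have hns := hgood i hiJ hvi
        rw [hti, Finset.disjoint_left] at hdi
        rw [hti] at hns ⊢
        simp only [Finset.mem_insert, Finset.mem_singleton, hP', not_forall,
          Finset.insert_subset_iff, Finset.singleton_subset_iff] at hdi hns ⊢
        by_cases haP : a ∈ P <;> by_cases hbP : b ∈ P
        · simp [haP, hbP] at hns
        · exact ⟨b, by simp, by simp [hbv, hbP], by simp [haP]⟩
        · exact ⟨a, by simp, by simp [hav, haP], by simp [hbP]⟩
        · obtain ⟨x, hx, hx'⟩ := hdi
          rcases hx with rfl | rfl | rfl <;> simp_all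
      obtain ⟨w, hwi, hwP', hw⟩ := hex
      rw [gasSat_insert hwP' K hwi, gasSat_of_subset K hw]
      have ha := h.occ hM0 hlam hz (by omega) hKst hwP'
      simp only [hf, if_neg hdi]
      have h8 := mul_nonneg (hlam w) (gasZ_nonneg hlam hz (t := t) (insert w P') K)
      nlinarith [hz i, mul_le_mul_of_nonneg_right (hz i) h8])
  have hprod : (1 - ζ * M ^ 2) ^ N * (1 - M) ^ j ≤ ∏ i ∈ G, (1 - f i) := by
    rw [← Finset.prod_filter_mul_prod_filter_not G (fun i => Disjoint (t i) P)]
    rw [Finset.prod_congr rfl (g := fun _ => 1 - ζ * M ^ 2) (by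
      intro i hi; simp [hf, (Finset.mem_filter.1 hi).2])]
    rw [Finset.prod_congr rfl (s₁ := G.filter (fun i => ¬ Disjoint (t i) P)) (g := fun _ => 1 - M) (by
      intro i hi; simp [hf, (Finset.mem_filter.1 hi).2])]
    rw [Finset.prod_const, Finset.prod_const]
    have c1 : (G.filter (fun i => Disjoint (t i) P)).card ≤ N := by
      refine (Finset.card_le_card ?_).trans (hN v)
      intro i hi
      simp only [hG, Finset.mem_filter] at hi
      simp [hi.1.2]
    have c2 : (G.filter (fun i => ¬ Disjoint (t i) P)).card ≤ j := by
      refine (Finset.card_le_card ?_).trans ((card_filter_meets_le hlin hv).trans hP)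
      intro i hi
      simp only [hG, Finset.mem_filter] at hi
      simp [hi.1.2, hi.2]
    have e0 : 0 ≤ ζ * M ^ 2 := by positivity
    exact mul_le_mul (pow_le_pow_of_le_one (by linarith) (by linarith) c1)
      (pow_le_pow_of_le_one (by linarith) (by linarith) c2)
      (pow_nonneg (by linarith) _) (pow_nonneg (by linarith) _)
  rw [hun] at key
  have hZ0 := gasZ_nonneg hlam hz (t := t) P' J₀
  have e1 := mul_le_mul_of_nonneg_right hprod hZ0
  have e2 := mul_le_mul (hl v) (e1.trans key) (by
    refine mul_nonneg (mul_nonneg (pow_nonneg (by linarith) _) (pow_nonneg (by linarith) _)) hZ0)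
    (hlam v)
  rw [← mul_assoc] at e2
  exact e2

lemma gasZ_congr_lam {lam' : V → ℝ} (P : Finset V) (J : Finset ι)
    (h : ∀ v ∉ P, lam v = lam' v) : gasZ t lam z P J = gasZ t lam' z P J := by
  refine Finset.sum_congr rfl fun S hS => ?_
  unfold gasWeight
  rw [Finset.prod_congr rfl fun v hv => h v (Finset.mem_compl.1 (Finset.mem_powerset.1 hS hv))]

lemma gasWeight_congr_z {z' : ι → ℝ} (P S : Finset V) (J : Finset ι)
    (h : ∀ i ∈ J, z i = z' i) : gasWeight t lam z P J S = gasWeight t lam z' P J S := by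
  unfold gasWeight
  congr 1
  exact Finset.prod_congr rfl fun i hi => by rw [h i hi]

lemma gasZ_congr_z {z' : ι → ℝ} (P : Finset V) (J : Finset ι)
    (h : ∀ i ∈ J, z i = z' i) : gasZ t lam z P J = gasZ t lam z' P J :=
  Finset.sum_congr rfl fun S _ => gasWeight_congr_z P S J h

lemma gasSat_congr_z {z' : ι → ℝ} (P : Finset V) (J : Finset ι) (k : ι)
    (h : ∀ i ∈ J, z i = z' i) : gasSat t lam z P J k = gasSat t lam z' P J k :=
  Finset.sum_congr rfl fun S _ => by rw [gasWeight_congr_z P S J h]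

/-- Exponential tilting of the activities. -/
lemma gasZ_tilt_le [Fintype ι] {r : V → ℝ} {M : ℝ} (hM : 0 ≤ M) (hr : ∀ v, 1 ≤ r v)
    (hl : ∀ v, 0 ≤ lam v) (hz : ∀ i, z i ≤ 1)
    (h : ∀ lam' : V → ℝ, (∀ v, lam v ≤ lam' v ∧ lam' v ≤ r v * lam v) → OddsLE t lam' z 0 M)
    (A : Finset V) :
    gasZ t (fun v => if v ∈ A then r v * lam v else lam v) z ∅ Finset.univ ≤
      Real.exp (∑ v ∈ A, (r v - 1) * M) * gasZ t lam z ∅ Finset.univ := by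
  induction A using Finset.induction_on with
  | empty => simp
  | insert v A hv ih =>
    set lam₁ : V → ℝ := fun w => if w ∈ A then r w * lam w else lam w with hlam₁
    set lam₂ : V → ℝ := fun w => if w ∈ insert v A then r w * lam w else lam w with hlam₂
    have hle : ∀ w, lam w ≤ r w * lam w := fun w => le_mul_of_one_le_left (hl w) (hr w)
    have hl₁ : ∀ w, lam w ≤ lam₁ w ∧ lam₁ w ≤ r w * lam w := fun w => by
      simp only [hlam₁]; split_ifs
      · exact ⟨hle w, le_rfl⟩
      · exact ⟨le_rfl, hle w⟩
    have hl₁0 : ∀ w, 0 ≤ lam₁ w := fun w => (hl w).trans (hl₁ w).1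
    have hocc := (h lam₁ hl₁).occ hM hl₁0 hz (P := ∅) (J := Finset.univ) (by simp) (by simp)
      (v := v) (by simp)
    have hcongr : ∀ J, gasZ t lam₂ z (insert v ∅) J = gasZ t lam₁ z (insert v ∅) J := fun J =>
      gasZ_congr_lam _ _ fun w hw => by
        have : w ≠ v := by simpa using hw
        simp [hlam₁, hlam₂, this]
    have h1 := gasZ_split (t := t) (lam := lam₁) (z := z) (v := v) (P := ∅) (by simp) Finset.univ
    have h2 := gasZ_split (t := t) (lam := lam₂) (z := z) (v := v) (P := ∅) (by simp) Finset.univ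
    rw [hcongr, hcongr] at h2
    have h3 : lam₂ v = r v * lam₁ v := by simp [hlam₁, hlam₂, hv]
    have hr1 : 0 ≤ r v - 1 := sub_nonneg.2 (hr v)
    have h4 := mul_le_mul_of_nonneg_left hocc hr1
    have hZ := gasZ_nonneg hl₁0 hz (t := t) ∅ Finset.univ
    have h5 : gasZ t lam₂ z ∅ Finset.univ ≤ (1 + (r v - 1) * M) * gasZ t lam₁ z ∅ Finset.univ := by
      rw [h2, h3]; nlinarith
    have h6 : 1 + (r v - 1) * M ≤ Real.exp ((r v - 1) * M) := by
      linarith [Real.add_one_le_exp ((r v - 1) * M)]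
    rw [Finset.sum_insert hv, Real.exp_add, mul_assoc]
    exact h5.trans (mul_le_mul h6 ih hZ (Real.exp_nonneg _))

/-- Exponential tilting of the constraint parameters. -/
lemma gasZ_constraint_tilt_le [Fintype ι] {r T : ℝ} (hl : ∀ v, 0 ≤ lam v) (hz : ∀ i, z i ≤ 1)
    (hr : 0 ≤ r)
    (h : ∀ z' : ι → ℝ, (∀ i, z' i = z i ∨ z' i = 1 - r * (1 - z i)) → ∀ i,
      (r - 1) * gasSat t lam z' ∅ (Finset.univ.erase i) i ≤
        (r - 1) * T * gasZ t lam z' ∅ Finset.univ) (A : Finset ι) :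
    gasZ t lam (fun i => if i ∈ A then 1 - r * (1 - z i) else z i) ∅ Finset.univ ≤
      Real.exp (∑ i ∈ A, (r - 1) * (1 - z i) * T) * gasZ t lam z ∅ Finset.univ := by
  induction A using Finset.induction_on with
  | empty => simp
  | insert k A hk ih =>
    set z₁ : ι → ℝ := fun i => if i ∈ A then 1 - r * (1 - z i) else z i with hz₁
    set z₂ : ι → ℝ := fun i => if i ∈ insert k A then 1 - r * (1 - z i) else z i with hz₂
    have hz₁' : ∀ i, z₁ i = z i ∨ z₁ i = 1 - r * (1 - z i) := fun i => by
      simp only [hz₁]; split_ifs <;> simp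
    have hz₁1 : ∀ i, z₁ i ≤ 1 := fun i => by
      rcases hz₁' i with h | h <;> rw [h]
      · exact hz i
      · have := mul_nonneg hr (sub_nonneg.2 (hz i)); linarith
    have hcongr : ∀ i ∈ Finset.univ.erase k, z₂ i = z₁ i := fun i hi => by
      have : i ≠ k := (Finset.mem_erase.1 hi).1
      simp [hz₁, hz₂, this]
    have hu : (Finset.univ : Finset ι) = insert k (Finset.univ.erase k) := by
      rw [Finset.insert_erase (Finset.mem_univ _)]
    have h1 := gasZ_insert_constraint (t := t) (lam := lam) (z := z₁) ∅
      (Finset.notMem_erase k Finset.univ)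
    have h2 := gasZ_insert_constraint (t := t) (lam := lam) (z := z₂) ∅
      (Finset.notMem_erase k Finset.univ)
    rw [← hu] at h1 h2
    rw [gasZ_congr_z _ _ hcongr, gasSat_congr_z _ _ _ hcongr] at h2
    have e1 : z₁ k = z k := by simp [hz₁, hk]
    have e2 : z₂ k = 1 - r * (1 - z k) := by simp [hz₂]
    have h3 := mul_le_mul_of_nonneg_left (h z₁ hz₁' k) (sub_nonneg.2 (hz k))
    have hZ := gasZ_nonneg hl hz₁1 (t := t) ∅ Finset.univ
    have h5 : gasZ t lam z₂ ∅ Finset.univ ≤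
        (1 + (r - 1) * (1 - z k) * T) * gasZ t lam z₁ ∅ Finset.univ := by
      rw [e1] at h1
      rw [h2, e2]; nlinarith
    have h6 : 1 + (r - 1) * (1 - z k) * T ≤ Real.exp ((r - 1) * (1 - z k) * T) := by
      linarith [Real.add_one_le_exp ((r - 1) * (1 - z k) * T)]
    rw [Finset.sum_insert hk, Real.exp_add, mul_assoc]
    exact h5.trans (mul_le_mul h6 ih hZ (Real.exp_nonneg _))

lemma exists_triple_eq (h3 : ∀ i, (t i).card = 3) (i : ι) :
    ∃ a b c, a ≠ b ∧ a ≠ c ∧ b ≠ c ∧ t i = {a, b, c} :=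
  Finset.card_eq_three.1 (h3 i)

lemma filter_erase_of_mem [Fintype ι] {i : ι} {c : V} (hc : c ∈ t i) :
    (Finset.univ.erase i).filter (fun k => c ∉ t k) = Finset.univ.filter (fun k => c ∉ t k) := by
  ext k
  simp only [Finset.mem_filter, Finset.mem_erase, Finset.mem_univ, and_true, true_and,
    and_iff_right_iff_imp]
  rintro h rfl
  exact h hc

lemma gasSat_triple [Fintype ι] {i : ι} {a b c : V} (hab : a ≠ b) (hac : a ≠ c) (hbc : b ≠ c)
    (hi : t i = {a, b, c}) (J : Finset ι) :
    gasSat t lam z ∅ J i = lam a * (lam b * (lam c * gasZ t lam z {c, b, a} J)) := by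
  rw [gasSat_insert (v := a) (by simp) J (by simp [hi]),
    gasSat_pair (a := b) (b := c) J (by simp [hab.symm]) (by simp [hac.symm]) hbc (by simp [hi])
      (by simp [hi]) (by rw [hi]; intro x; simp; tauto)]
  simp

lemma OddsLE.gasSat_le [Fintype ι] (h3 : ∀ i, (t i).card = 3) {M : ℝ} (hM : 0 ≤ M)
    (hl : ∀ v, 0 ≤ lam v) (hz : ∀ i, z i ≤ 1) (h : OddsLE t lam z 2 M) (i : ι) :
    gasSat t lam z ∅ (Finset.univ.erase i) i ≤ M ^ 3 * gasZ t lam z ∅ Finset.univ := by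
  obtain ⟨a, b, c, hab, hac, hbc, hi⟩ := exists_triple_eq h3 i
  rw [gasSat_triple hab hac hbc hi]
  have h1 := h.occ hM hl hz (P := ∅) (J := Finset.univ) (by simp) (by simp) (v := a) (by simp)
  have h2 := h.occ hM hl hz (P := {a}) (J := Finset.univ) (by simp) (by simp) (v := b)
    (by simp [hab.symm])
  have h3' := h {b, a} (Finset.univ.erase i) Finset.card_le_two (fun k hk => by
      refine Finset.mem_erase.2 ⟨?_, Finset.mem_univ _⟩
      rintro rfl
      rw [hi] at hk
      simp at hk) c (by simp [hac.symm, hbc.symm])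
  rw [filter_erase_of_mem (by simp [hi])] at h3'
  have h4 := gasZ_split (t := t) (lam := lam) (z := z) (v := c) (P := {b, a})
    (by simp [hac.symm, hbc.symm]) Finset.univ
  have h5 := mul_nonneg (hl c) (gasZ_nonneg hl hz (t := t) (insert c {b, a}) Finset.univ)
  have h6 : lam c * gasZ t lam z {c, b, a} (Finset.univ.erase i) ≤
      M * gasZ t lam z {b, a} Finset.univ :=
    h3'.trans (mul_le_mul_of_nonneg_left (by linarith) hM)
  calc _ ≤ lam a * (lam b * (M * gasZ t lam z {b, a} Finset.univ)) :=
        mul_le_mul_of_nonneg_left (mul_le_mul_of_nonneg_left h6 (hl b)) (hl a)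
    _ = lam a * M * (lam b * gasZ t lam z {b, a} Finset.univ) := by ring
    _ ≤ lam a * M * (M * gasZ t lam z {a} Finset.univ) :=
        mul_le_mul_of_nonneg_left h2 (mul_nonneg (hl a) hM)
    _ = M ^ 2 * (lam a * gasZ t lam z {a} Finset.univ) := by ring
    _ ≤ M ^ 2 * (M * gasZ t lam z ∅ Finset.univ) :=
        mul_le_mul_of_nonneg_left h1 (by positivity)
    _ = _ := by ring

lemma OddsGE.le_gasSat [Fintype ι] (h3 : ∀ i, (t i).card = 3) (hlin : IsLinearFamily t) {m : ℝ}
    (hm : 0 ≤ m) (hl : ∀ v, 0 ≤ lam v) (hz0 : ∀ i, 0 ≤ z i) (hz : ∀ i, z i ≤ 1)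
    (h : OddsGE t lam z 2 m) (i : ι) :
    (m / (1 + m)) ^ 3 * gasZ t lam z ∅ Finset.univ ≤
      gasSat t lam z ∅ (Finset.univ.erase i) i := by
  obtain ⟨a, b, c, hab, hac, hbc, hi⟩ := exists_triple_eq h3 i
  rw [gasSat_triple hab hac hbc hi]
  have h1 := h.occ hm (P := ∅) (J := Finset.univ) (by simp) (by simp) (v := a) (by simp)
    (fun k _ _ hk => by
      have := Finset.card_le_card hk
      rw [h3] at this
      simp at this)
  have h2 := h.occ hm (P := {a}) (J := Finset.univ) (by simp) (by simp) (v := b)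
    (by simp [hab.symm]) (fun k _ _ hk => by
      have := (Finset.card_le_card hk).trans Finset.card_le_two
      rw [h3] at this
      simp at this)
  have h3' := h {b, a} (Finset.univ.erase i) Finset.card_le_two (fun k hk => by
      refine Finset.mem_erase.2 ⟨?_, Finset.mem_univ _⟩
      rintro rfl
      rw [hi] at hk
      simp at hk) c (by simp [hac.symm, hbc.symm]) (fun k hk hck hsub => by
      have hc : ({c, b, a} : Finset V).card ≤ 3 := Finset.card_le_three
      have hak : t k = {c, b, a} := Finset.eq_of_subset_of_card_le hsub (by rw [h3]; exact hc)
      refine (Finset.mem_erase.1 hk).1 (hlin k i a b hab ?_ ?_ ?_ ?_) <;> simp [hak, hi])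
  rw [filter_erase_of_mem (by simp [hi])] at h3'
  have h4 := gasZ_split (t := t) (lam := lam) (z := z) (v := c) (P := {b, a})
    (by simp [hac.symm, hbc.symm]) Finset.univ
  have h5 := mul_le_mul_of_nonneg_left (gasZ_antitone (t := t) hl hz0 hz {c, b, a}
    (Finset.erase_subset i Finset.univ)) (hl c)
  have h6 : m / (1 + m) * gasZ t lam z {b, a} Finset.univ ≤
      lam c * gasZ t lam z {c, b, a} (Finset.univ.erase i) := by
    rw [div_mul_eq_mul_div, div_le_iff₀ (by linarith), h4]
    nlinarith
  have hθ : 0 ≤ m / (1 + m) := by positivity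
  set θ := m / (1 + m)
  calc _ = θ ^ 2 * (θ * gasZ t lam z ∅ Finset.univ) := by ring
    _ ≤ θ ^ 2 * (lam a * gasZ t lam z {a} Finset.univ) :=
        mul_le_mul_of_nonneg_left h1 (by positivity)
    _ = lam a * θ * (θ * gasZ t lam z {a} Finset.univ) := by ring
    _ ≤ lam a * θ * (lam b * gasZ t lam z {b, a} Finset.univ) :=
        mul_le_mul_of_nonneg_left h2 (mul_nonneg (hl a) hθ)
    _ = lam a * (lam b * (θ * gasZ t lam z {b, a} Finset.univ)) := by ring
    _ ≤ _ := mul_le_mul_of_nonneg_left (mul_le_mul_of_nonneg_left h6 (hl b)) (hl a)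

end Hypergraph

/-- The potential edges of a graph on `Fin n`. -/
abbrev PotEdge (n : ℕ) : Type := {e : Sym2 (Fin n) // ¬ e.IsDiag}

/-- The potential triangles of a graph on `Fin n`. -/
abbrev PotTri (n : ℕ) : Type := {s : Finset (Fin n) // s.card = 3}

/-- The three edges of a potential triangle. -/
def triEdges (n : ℕ) (s : PotTri n) : Finset (PotEdge n) :=
  Finset.univ.filter (fun e => ∀ x ∈ e.1, x ∈ s.1)

lemma mem_triEdges {n : ℕ} {s : PotTri n} {e : PotEdge n} :
    e ∈ triEdges n s ↔ ∀ x ∈ e.1, x ∈ s.1 := by simp [triEdges]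

lemma PotEdge.exists_eq {n : ℕ} (e : PotEdge n) :
    ∃ (a b : Fin n) (h : ¬ (s(a, b) : Sym2 (Fin n)).IsDiag), a ≠ b ∧ e = ⟨s(a, b), h⟩ := by
  obtain ⟨e, he⟩ := e
  induction e using Sym2.ind with
  | _ a b => exact ⟨a, b, he, by simpa using he, rfl⟩

lemma card_triEdges {n : ℕ} (s : PotTri n) : (triEdges n s).card = 3 := by
  obtain ⟨s, hs⟩ := s
  obtain ⟨x, y, w, hxy, hxw, hyw, rfl⟩ := Finset.card_eq_three.1 hs
  refine Finset.card_eq_three.2 ⟨⟨s(x, y), by simpa⟩, ⟨s(x, w), by simpa⟩, ⟨s(y, w), by simpa⟩,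
    ?_, ?_, ?_, ?_⟩
  · simp [Subtype.ext_iff]; tauto
  · simp [Subtype.ext_iff]; tauto
  · simp [Subtype.ext_iff]; tauto
  · ext e
    obtain ⟨a, b, h, hab, rfl⟩ := e.exists_eq
    simp only [mem_triEdges, Sym2.mem_iff, forall_eq_or_imp, forall_eq, Finset.mem_insert,
      Finset.mem_singleton, Subtype.ext_iff, Sym2.eq_iff]
    constructor
    · rintro ⟨rfl | rfl | rfl, rfl | rfl | rfl⟩ <;> simp_all
    · rintro ((⟨rfl, rfl⟩ | ⟨rfl, rfl⟩) | (⟨rfl, rfl⟩ | ⟨rfl, rfl⟩) | (⟨rfl, rfl⟩ | ⟨rfl, rfl⟩)) <;>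
        simp

lemma isLinearFamily_triEdges (n : ℕ) : IsLinearFamily (triEdges n) := by
  intro s s' e e' hne h1 h2 h3 h4
  obtain ⟨a, b, h, hab, rfl⟩ := e.exists_eq
  obtain ⟨a', b', h', hab', rfl⟩ := e'.exists_eq
  simp only [mem_triEdges, Sym2.mem_iff, forall_eq_or_imp, forall_eq] at h1 h2 h3 h4
  obtain ⟨w, hw, hwa, hwb⟩ : ∃ w, (w = a' ∨ w = b') ∧ w ≠ a ∧ w ≠ b := by
    by_contra hcon
    push Not at hcon
    have k1 := hcon a' (Or.inl rfl)
    have k2 := hcon b' (Or.inr rfl)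
    refine hne (Subtype.ext ?_)
    simp only [Sym2.eq_iff]
    by_cases e1 : a' = a <;> by_cases e2 : b' = a
    · exact absurd (e1.trans e2.symm) hab'
    · exact Or.inl ⟨e1.symm, (k2 e2).symm⟩
    · exact Or.inr ⟨e2.symm, (k1 e1).symm⟩
    · exact absurd ((k1 e1).trans (k2 e2).symm) hab'
  have hcard : ({a, b, w} : Finset (Fin n)).card = 3 :=
    Finset.card_eq_three.2 ⟨a, b, w, hab, hwa.symm, hwb.symm, rfl⟩
  have hs : ({a, b, w} : Finset (Fin n)) = s.1 := by
    refine Finset.eq_of_subset_of_card_le ?_ (by rw [hcard, s.2])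
    intro x hx
    simp only [Finset.mem_insert, Finset.mem_singleton] at hx
    rcases hx with rfl | rfl | rfl
    · exact h1.1
    · exact h1.2
    · rcases hw with rfl | rfl
      · exact h2.1
      · exact h2.2
  have hs' : ({a, b, w} : Finset (Fin n)) = s'.1 := by
    refine Finset.eq_of_subset_of_card_le ?_ (by rw [hcard, s'.2])
    intro x hx
    simp only [Finset.mem_insert, Finset.mem_singleton] at hx
    rcases hx with rfl | rfl | rfl
    · exact h3.1
    · exact h3.2
    · rcases hw with rfl | rfl
      · exact h4.1
      · exact h4.2
  exact Subtype.ext (hs.symm.trans hs')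

lemma degree_triEdges {n : ℕ} (e : PotEdge n) :
    (Finset.univ.filter (fun s => e ∈ triEdges n s)).card = n - 2 := by
  obtain ⟨a, b, h, hab, rfl⟩ := e.exists_eq
  have hc : (({a, b} : Finset (Fin n))ᶜ).card = n - 2 := by
    rw [Finset.card_compl, Finset.card_pair hab, Fintype.card_fin]
  rw [← hc]
  symm
  have h3 : ∀ w ∈ ({a, b} : Finset (Fin n))ᶜ, ({a, b, w} : Finset (Fin n)).card = 3 := by
    intro w hw
    simp only [Finset.mem_compl, Finset.mem_insert, Finset.mem_singleton, not_or] at hw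
    exact Finset.card_eq_three.2 ⟨a, b, w, hab, Ne.symm hw.1, Ne.symm hw.2, rfl⟩
  refine Finset.card_bij (fun w hw => ⟨{a, b, w}, h3 w hw⟩) ?_ ?_ ?_
  · intro w hw
    simp [mem_triEdges]
  · intro w hw w' hw' heq
    simp only [Finset.mem_compl, Finset.mem_insert, Finset.mem_singleton, not_or] at hw hw'
    have h1 : w ∈ ({a, b, w'} : Finset (Fin n)) := by
      have hh : ({a, b, w} : Finset (Fin n)) = {a, b, w'} := congrArg Subtype.val heq
      rw [← hh]; simp
    simpa [hw.1, hw.2] using h1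
  · rintro ⟨s, hs⟩ hm
    simp only [Finset.mem_filter, Finset.mem_univ, true_and, mem_triEdges, Sym2.mem_iff,
      forall_eq_or_imp, forall_eq] at hm
    have hsub : ({a, b} : Finset (Fin n)) ⊆ s := by
      intro x; simp only [Finset.mem_insert, Finset.mem_singleton]; rintro (rfl | rfl)
      · exact hm.1
      · exact hm.2
    have h1 : (s \ {a, b}).card = 1 := by
      rw [Finset.card_sdiff_of_subset hsub, hs, Finset.card_pair hab]
    obtain ⟨w, hw⟩ := Finset.card_eq_one.1 h1
    have hws : w ∈ s \ {a, b} := by simp [hw]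
    refine ⟨w, ?_, Subtype.ext ?_⟩
    · rw [Finset.mem_compl]; exact (Finset.mem_sdiff.1 hws).2
    · have := Finset.sdiff_union_of_subset hsub
      rw [hw] at this
      refine Eq.trans ?_ this
      ext x; simp only [Finset.mem_insert, Finset.mem_union, Finset.mem_singleton]; tauto

lemma OddsLE.mono {V ι : Type*} [Fintype V] [DecidableEq V] [DecidableEq ι] {t : ι → Finset V}
    {lam : V → ℝ} {z : ι → ℝ} {j : ℕ} {M M' : ℝ} (h : OddsLE t lam z j M)
    (hl : ∀ v, 0 ≤ lam v) (hz : ∀ i, z i ≤ 1) (hM : M ≤ M') : OddsLE t lam z j M' :=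
  fun P J hP hJ v hv =>
    (h P J hP hJ v hv).trans (mul_le_mul_of_nonneg_right hM (gasZ_nonneg hl hz _ _))

lemma OddsGE.mono {V ι : Type*} [Fintype V] [DecidableEq V] [DecidableEq ι] {t : ι → Finset V}
    {lam : V → ℝ} {z : ι → ℝ} {j : ℕ} {m m' : ℝ} (h : OddsGE t lam z j m)
    (hl : ∀ v, 0 ≤ lam v) (hz : ∀ i, z i ≤ 1) (hm : m' ≤ m) : OddsGE t lam z j m' :=
  fun P J hP hJ v hv hg =>
    (mul_le_mul_of_nonneg_right hm (gasZ_nonneg hl hz _ _)).trans (h P J hP hJ v hv hg)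

/-- Parameters of the triangle lattice gas within `τ` of the homogeneous ones. -/
def NearParams (c ζ τ : ℝ) (n : ℕ) (lam : PotEdge n → ℝ) (z : PotTri n → ℝ) : Prop :=
  (∀ v, 0 ≤ lam v ∧ |Real.sqrt n * lam v - c| ≤ τ) ∧
    ∀ i, 0 ≤ z i ∧ z i ≤ 1 ∧ |z i - ζ| ≤ τ

lemma NearParams.mono {c ζ τ τ' : ℝ} {n : ℕ} {lam : PotEdge n → ℝ} {z : PotTri n → ℝ}
    (h : NearParams c ζ τ n lam z) (hτ : τ ≤ τ') : NearParams c ζ τ' n lam z :=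
  ⟨fun v => ⟨(h.1 v).1, (h.1 v).2.trans hτ⟩,
    fun i => ⟨(h.2 i).1, (h.2 i).2.1, (h.2 i).2.2.trans hτ⟩⟩

/-- Asymptotic upper bound `X / √n` on the odds of an edge, robust under perturbations. -/
def OddsUpper (c ζ X : ℝ) : Prop :=
  ∀ j : ℕ, ∃ τ > 0, ∀ᶠ n : ℕ in atTop, ∀ lam z, NearParams c ζ τ n lam z →
    OddsLE (triEdges n) lam z j (X / Real.sqrt n)

/-- Asymptotic lower bound `Y / √n` on the odds of an edge, robust under perturbations. -/
def OddsLower (c ζ Y : ℝ) : Prop :=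
  ∀ j : ℕ, ∃ τ > 0, ∀ᶠ n : ℕ in atTop, ∀ lam z, NearParams c ζ τ n lam z →
    OddsGE (triEdges n) lam z j (Y / Real.sqrt n)

lemma tendsto_sqrt_natCast : Tendsto (fun n : ℕ => Real.sqrt n) atTop atTop :=
  Real.tendsto_sqrt_atTop.comp tendsto_natCast_atTop_atTop

lemma tendsto_div_sqrt_natCast (Y : ℝ) :
    Tendsto (fun n : ℕ => Y / Real.sqrt n) atTop (nhds 0) :=
  tendsto_sqrt_natCast.const_div_atTop Y

lemma tendsto_natSub_div (r : ℕ) :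
    Tendsto (fun n : ℕ => ((n - r : ℕ) : ℝ) / n) atTop (nhds 1) := by
  have h : Tendsto (fun n : ℕ => 1 - (r : ℝ) / n) atTop (nhds (1 - 0)) :=
    tendsto_const_nhds.sub (tendsto_const_div_atTop_nhds_zero_nat (r : ℝ))
  rw [sub_zero] at h
  refine h.congr' ?_
  filter_upwards [eventually_ge_atTop (r + 1)] with n hn
  have hn0 : (n : ℝ) ≠ 0 := by
    have : n ≠ 0 := by omega
    exact_mod_cast this
  rw [Nat.cast_sub (by omega)]
  field_simp

lemma OddsLower.oddsUpper {c ζ X Y : ℝ} (hc : 0 < c) (hζ : 0 < ζ) (hζ1 : ζ ≤ 1) (hY : 0 ≤ Y)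
    (hX : c * Real.exp (-(ζ * Y ^ 2)) < X) (h : OddsLower c ζ Y) : OddsUpper c ζ X := by
  intro j
  obtain ⟨τ₀, hτ₀, h⟩ := h (j + 2)
  obtain ⟨τ, ⟨hτ0, hτ1⟩, hτX⟩ : ∃ τ ∈ Set.Ioo 0 (min τ₀ ζ),
      (c + τ) * Real.exp (-((ζ - τ) * Y ^ 2)) < X := by
    have hcont : Tendsto (fun τ : ℝ => (c + τ) * Real.exp (-((ζ - τ) * Y ^ 2))) (nhds 0)
        (nhds ((c + 0) * Real.exp (-((ζ - 0) * Y ^ 2)))) := by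
      apply Continuous.tendsto (by fun_prop)
    rw [add_zero, sub_zero] at hcont
    have h1 := (hcont.eventually (gt_mem_nhds hX)).filter_mono
      (nhdsWithin_le_nhds (s := Set.Ioi 0))
    obtain ⟨τ, h2, h3⟩ := (h1.and (Ioo_mem_nhdsGT (lt_min hτ₀ hζ))).exists
    exact ⟨τ, h3, h2⟩
  have hτζ : τ < ζ := hτ1.trans_le (min_le_right _ _)
  refine ⟨τ, hτ0, ?_⟩
  set r := 2 + (j + (j + 1) ^ 2) with hr
  set θ : ℕ → ℝ := fun n => Y / Real.sqrt n / (1 + Y / Real.sqrt n) with hθ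
  have hθ0 : ∀ n, 0 ≤ θ n := fun n => by simp only [hθ]; positivity
  have hlim : Tendsto (fun n : ℕ => (c + τ) *
      Real.exp (-((ζ - τ) * ((Y / (1 + Y / Real.sqrt n)) ^ 2 * (((n - r : ℕ) : ℝ) / n)))))
      atTop (nhds ((c + τ) * Real.exp (-((ζ - τ) * ((Y / (1 + 0)) ^ 2 * 1))))) := by
    refine Tendsto.const_mul _ ((Real.continuous_exp.tendsto _).comp ?_)
    refine Tendsto.neg (Tendsto.const_mul _ (Tendsto.mul (Tendsto.pow ?_ 2) (tendsto_natSub_div r)))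
    exact Tendsto.div tendsto_const_nhds (tendsto_const_nhds.add (tendsto_div_sqrt_natCast Y))
      (by norm_num)
  rw [add_zero, div_one, mul_one] at hlim
  filter_upwards [h, hlim.eventually (gt_mem_nhds hτX), eventually_gt_atTop 0] with n hn hnX hn0
    lam z hp
  have hs : 0 < Real.sqrt n := Real.sqrt_pos.2 (by exact_mod_cast hn0)
  have hsq : Real.sqrt n ^ 2 = n := Real.sq_sqrt (by positivity)
  have hlow := hn lam z (hp.mono (hτ1.trans_le (min_le_left _ _)).le)
  have hlL : ∀ v, lam v ≤ (c + τ) / Real.sqrt n := fun v => by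
    rw [le_div_iff₀ hs]
    linarith [(abs_le.1 (hp.1 v).2).2]
  have hup := hlow.oddsLE card_triEdges (isLinearFamily_triEdges n) (N := n - 2)
    (fun v => (degree_triEdges v).ge) (fun v => (hp.1 v).1) hlL (fun i => (hp.2 i).2.1)
    (ζ := ζ - τ) (by linarith) (fun i => by linarith [(abs_le.1 (hp.2 i).2.2).1])
    (by positivity)
  refine hup.mono (fun v => (hp.1 v).1) (fun i => (hp.2 i).2.1) ?_
  rw [div_mul_eq_mul_div]
  refine div_le_div_of_nonneg_right (le_trans ?_ hnX.le) hs.le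
  refine mul_le_mul_of_nonneg_left ?_ (by linarith)
  have hN : n - 2 - (j + (j + 1) ^ 2) = n - r := by omega
  rw [hN]
  have hθ1 : θ n ≤ 1 := by
    simp only [hθ]
    have : 0 ≤ Y / Real.sqrt n := by positivity
    rw [div_le_one (by linarith)]; linarith
  have hθsq : (θ n) ^ 2 ≤ 1 := pow_le_one₀ (hθ0 n) hθ1
  have h1 : 1 - (ζ - τ) * (θ n) ^ 2 ≤ Real.exp (-((ζ - τ) * (θ n) ^ 2)) := by
    linarith [Real.add_one_le_exp (-((ζ - τ) * (θ n) ^ 2))]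
  have h2 : 0 ≤ 1 - (ζ - τ) * (θ n) ^ 2 := by nlinarith [sq_nonneg (θ n)]
  refine (pow_le_pow_left₀ h2 h1 _).trans (le_of_eq ?_)
  rw [← Real.exp_nat_mul]
  congr 1
  have h3 : θ n = Y / (1 + Y / Real.sqrt n) / Real.sqrt n := by
    simp only [hθ]; rw [div_right_comm]
  rw [h3, div_pow _ (Real.sqrt n), hsq]
  ring

lemma OddsUpper.oddsLower {c ζ X Y : ℝ} (hc : 0 < c) (hζ : 0 < ζ) (hX0 : 0 ≤ X)
    (hY : Y < c * Real.exp (-(ζ * X ^ 2))) (h : OddsUpper c ζ X) : OddsLower c ζ Y := by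
  intro j
  obtain ⟨τ₀, hτ₀, h⟩ := h (j + 2)
  obtain ⟨τ, ⟨hτ0, hτ1⟩, hτY⟩ : ∃ τ ∈ Set.Ioo 0 (min τ₀ c),
      Y < (c - τ) * Real.exp (-(ζ + τ) * X ^ 2) := by
    have hcont : Tendsto (fun τ : ℝ => (c - τ) * Real.exp (-(ζ + τ) * X ^ 2)) (nhds 0)
        (nhds ((c - 0) * Real.exp (-(ζ + 0) * X ^ 2))) := by
      apply Continuous.tendsto (by fun_prop)
    rw [add_zero, sub_zero, neg_mul] at hcont
    have h1 := (hcont.eventually (lt_mem_nhds hY)).filter_mono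
      (nhdsWithin_le_nhds (s := Set.Ioi 0))
    obtain ⟨τ, h2, h3⟩ := (h1.and (Ioo_mem_nhdsGT (lt_min hτ₀ hc))).exists
    exact ⟨τ, h3, h2⟩
  have hτc : τ < c := hτ1.trans_le (min_le_right _ _)
  refine ⟨τ, hτ0, ?_⟩
  have hlim : Tendsto (fun n : ℕ => (c - τ) * ((1 + (-(ζ + τ) * X ^ 2) / n) ^ n *
      (1 - X / Real.sqrt n) ^ j)) atTop
      (nhds ((c - τ) * (Real.exp (-(ζ + τ) * X ^ 2) * (1 - 0) ^ j))) :=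
    ((Real.tendsto_one_add_div_pow_exp _).mul
      ((tendsto_const_nhds.sub (tendsto_div_sqrt_natCast X)).pow j)).const_mul _
  rw [sub_zero, one_pow, mul_one] at hlim
  have hM : ∀ᶠ n : ℕ in atTop, X / Real.sqrt n < 1 :=
    (tendsto_div_sqrt_natCast X).eventually (gt_mem_nhds one_pos)
  have hζM : ∀ᶠ n : ℕ in atTop, (ζ + τ) * (X / Real.sqrt n) ^ 2 < 1 := by
    have := ((tendsto_div_sqrt_natCast X).pow 2).const_mul (ζ + τ)
    refine this.eventually (gt_mem_nhds ?_)
    norm_num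
  filter_upwards [h, hlim.eventually (lt_mem_nhds hτY), eventually_gt_atTop 0, hM, hζM] with n hn
    hnY hn0 hM hζM lam z hp
  have hs : 0 < Real.sqrt n := Real.sqrt_pos.2 (by exact_mod_cast hn0)
  have hsq : Real.sqrt n ^ 2 = n := Real.sq_sqrt (by positivity)
  have hup := hn lam z (hp.mono (hτ1.trans_le (min_le_left _ _)).le)
  have hl : ∀ v, (c - τ) / Real.sqrt n ≤ lam v := fun v => by
    rw [div_le_iff₀ hs]
    linarith [(abs_le.1 (hp.1 v).2).1]
  have hlow := hup.oddsGE card_triEdges (isLinearFamily_triEdges n) (N := n)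
    (fun v => (degree_triEdges v).le.trans (Nat.sub_le _ _))
    (div_nonneg (by linarith) hs.le) hl (fun i => (hp.2 i).1) (fun i => (hp.2 i).2.1)
    (ζ := ζ + τ) (by linarith) (fun i => by linarith [(abs_le.1 (hp.2 i).2.2).2])
    (by positivity) hM.le hζM.le
  refine hlow.mono (fun v => (hp.1 v).1) (fun i => (hp.2 i).2.1) ?_
  rw [div_mul_eq_mul_div]
  refine div_le_div_of_nonneg_right (hnY.le.trans (le_of_eq ?_)) hs.le
  rw [div_pow, hsq]
  ring

lemma OddsLower.zero (c ζ : ℝ) : OddsLower c ζ 0 := by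
  refine fun j => ⟨1, one_pos, Eventually.of_forall fun n lam z hp P J _ _ v _ _ => ?_⟩
  rw [zero_div, zero_mul]
  exact mul_nonneg (hp.1 v).1 (gasZ_nonneg (fun v => (hp.1 v).1) (fun i => (hp.2 i).2.1) _ _)

lemma OddsUpper.mono {c ζ X X' : ℝ} (h : OddsUpper c ζ X) (hX : X ≤ X') : OddsUpper c ζ X' := by
  intro j
  obtain ⟨τ, hτ, h⟩ := h j
  refine ⟨τ, hτ, h.mono fun n hn lam z hp => ?_⟩
  exact (hn lam z hp).mono (fun v => (hp.1 v).1) (fun i => (hp.2 i).2.1)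
    (div_le_div_of_nonneg_right hX (Real.sqrt_nonneg _))

lemma OddsLower.mono {c ζ Y Y' : ℝ} (h : OddsLower c ζ Y) (hY : Y' ≤ Y) : OddsLower c ζ Y' := by
  intro j
  obtain ⟨τ, hτ, h⟩ := h j
  refine ⟨τ, hτ, h.mono fun n hn lam z hp => ?_⟩
  exact (hn lam z hp).mono (fun v => (hp.1 v).1) (fun i => (hp.2 i).2.1)
    (div_le_div_of_nonneg_right hY (Real.sqrt_nonneg _))

/-- The recursion map is a contraction below the uniqueness threshold. -/
lemma abs_exp_neg_sq_sub_le {c ζ : ℝ} (hc : 0 < c) (hζ : 0 < ζ) (x y : ℝ) :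
    |c * Real.exp (-(ζ * x ^ 2)) - c * Real.exp (-(ζ * y ^ 2))| ≤
      Real.sqrt (2 * ζ * c ^ 2 / Real.exp 1) * |x - y| := by
  have hd : ∀ u : ℝ, HasDerivAt (fun u : ℝ => c * Real.exp (-(ζ * u ^ 2)))
      (c * (Real.exp (-(ζ * u ^ 2)) * (-(ζ * (2 * u))))) u := by
    intro u
    have h1 : HasDerivAt (fun u : ℝ => -(ζ * u ^ 2)) (-(ζ * (2 * u))) u := by
      simpa using ((hasDerivAt_pow 2 u).const_mul ζ).fun_neg
    exact h1.exp.const_mul c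
  have hb : ∀ u : ℝ, ‖c * (Real.exp (-(ζ * u ^ 2)) * (-(ζ * (2 * u))))‖ ≤
      Real.sqrt (2 * ζ * c ^ 2 / Real.exp 1) := by
    intro u
    rw [Real.norm_eq_abs]
    refine Real.le_sqrt_of_sq_le ?_
    rw [sq_abs, le_div_iff₀ (Real.exp_pos 1)]
    have h1 : 2 * ζ * u ^ 2 ≤ Real.exp (2 * ζ * u ^ 2 - 1) := by
      linarith [Real.add_one_le_exp (2 * ζ * u ^ 2 - 1)]
    have h2 : Real.exp (-(ζ * u ^ 2)) ^ 2 * Real.exp 1 * Real.exp (2 * ζ * u ^ 2 - 1) = 1 := by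
      rw [← Real.exp_nat_mul, ← Real.exp_add, ← Real.exp_add, Real.exp_eq_one_iff]
      push_cast; ring
    have h3 : Real.exp (-(ζ * u ^ 2)) ^ 2 * Real.exp 1 * (2 * ζ * u ^ 2) ≤ 1 := by
      exact (mul_le_mul_of_nonneg_left h1 (by positivity)).trans h2.le
    calc _ = 2 * ζ * c ^ 2 * (Real.exp (-(ζ * u ^ 2)) ^ 2 * Real.exp 1 * (2 * ζ * u ^ 2)) := by ring
      _ ≤ 2 * ζ * c ^ 2 * 1 := mul_le_mul_of_nonneg_left h3 (by positivity)
      _ = _ := mul_one _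
  have := Convex.norm_image_sub_le_of_norm_hasDerivWithin_le (s := Set.univ)
    (fun u _ => (hd u).hasDerivWithinAt) (fun u _ => hb u) convex_univ (Set.mem_univ y)
    (Set.mem_univ x)
  simpa [Real.norm_eq_abs] using this

/-- Below the uniqueness threshold the odds are asymptotic to `x / √n`. -/
lemma oddsUpper_and_oddsLower {c ζ x : ℝ} (hc : 0 < c) (hζ : 0 < ζ) (hζ1 : ζ ≤ 1)
    (hu : 2 * ζ * c ^ 2 < Real.exp 1) (hx0 : 0 < x) (hx : x = c * Real.exp (-(ζ * x ^ 2)))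
    {δ : ℝ} (hδ : 0 < δ) : OddsUpper c ζ (x + δ) ∧ OddsLower c ζ (max 0 (x - δ)) := by
  set ρ := Real.sqrt (2 * ζ * c ^ 2 / Real.exp 1) with hρ
  have hρ0 : 0 ≤ ρ := Real.sqrt_nonneg _
  have hρ1 : ρ < 1 := by
    rw [hρ, Real.sqrt_lt' one_pos, one_pow, div_lt_one (Real.exp_pos 1)]
    exact hu
  obtain ⟨ρ', hρρ', hρ'1⟩ := exists_between hρ1
  have hxc : x ≤ c := by
    rw [hx]
    refine mul_le_of_le_one_right hc.le (Real.exp_le_one_iff.2 ?_)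
    have : 0 ≤ ζ * x ^ 2 := by positivity
    linarith
  have key : ∀ k : ℕ, OddsUpper c ζ (x + ρ' ^ k * (c + 1)) ∧
      OddsLower c ζ (max 0 (x - ρ' ^ k * (c + 1))) := by
    intro k
    induction k with
    | zero =>
      refine ⟨(OddsLower.zero c ζ).oddsUpper hc hζ hζ1 le_rfl ?_, ?_⟩
      · norm_num; linarith
      · rw [pow_zero, one_mul, max_eq_left (by linarith)]
        exact OddsLower.zero c ζ
    | succ k ih =>
      have hd : 0 < ρ' ^ k * (c + 1) := mul_pos (pow_pos (hρ0.trans_lt hρρ') _) (by linarith)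
      rw [pow_succ', mul_assoc]
      set d := ρ' ^ k * (c + 1)
      have hdd : ρ * d < ρ' * d := mul_lt_mul_of_pos_right hρρ' hd
      constructor
      · refine ih.2.oddsUpper hc hζ hζ1 (le_max_left _ _) ?_
        have h1 := abs_exp_neg_sq_sub_le hc hζ (max 0 (x - d)) x
        rw [← hx] at h1
        have h2 : |max 0 (x - d) - x| ≤ d := by
          rw [abs_le]
          constructor
          · linarith [le_max_right 0 (x - d)]
          · have : max 0 (x - d) ≤ x := max_le hx0.le (by linarith)
            linarith
        have h3 := mul_le_mul_of_nonneg_left h2 hρ0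
        linarith [(abs_le.1 h1).2]
      · by_cases hneg : x - ρ' * d ≤ 0
        · rw [max_eq_left hneg]; exact OddsLower.zero c ζ
        · rw [max_eq_right (not_le.1 hneg).le]
          refine ih.1.oddsLower hc hζ (by linarith) ?_
          have h1 := abs_exp_neg_sq_sub_le hc hζ (x + d) x
          rw [← hx, add_sub_cancel_left, abs_of_pos hd] at h1
          linarith [(abs_le.1 h1).1]
  obtain ⟨k, hk⟩ := exists_pow_lt_of_lt_one (show 0 < δ / (c + 1) by positivity) hρ'1
  rw [lt_div_iff₀ (by linarith)] at hk
  obtain ⟨h1, h2⟩ := key k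
  exact ⟨h1.mono (by linarith), h2.mono (max_le_max le_rfl (by linarith))⟩

/-- The edges of a graph as a set of sites. -/
def edgeSites {n : ℕ} (G : SimpleGraph (Fin n)) : Finset (PotEdge n) :=
  Finset.univ.filter (fun e => e.1 ∈ G.edgeSet)

lemma mem_edgeSites {n : ℕ} {G : SimpleGraph (Fin n)} {e : PotEdge n} :
    e ∈ edgeSites G ↔ e.1 ∈ G.edgeSet := by simp [edgeSites]

lemma edgeSites_bijective (n : ℕ) :
    Function.Bijective (edgeSites : SimpleGraph (Fin n) → Finset (PotEdge n)) := by
  constructor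
  · intro G H h
    refine SimpleGraph.edgeSet_injective (Set.ext fun e => ?_)
    by_cases he : e.IsDiag
    · exact ⟨fun h' => (G.not_isDiag_of_mem_edgeSet h' he).elim,
        fun h' => (H.not_isDiag_of_mem_edgeSet h' he).elim⟩
    · have := Finset.ext_iff.1 h ⟨e, he⟩
      simpa only [mem_edgeSites] using this
  · intro S
    refine ⟨SimpleGraph.fromEdgeSet (Subtype.val '' (S : Set (PotEdge n))), ?_⟩
    ext e
    rw [mem_edgeSites, SimpleGraph.edgeSet_fromEdgeSet]
    simp [e.2]

lemma sum_edgeSites {n : ℕ} (F : Finset (PotEdge n) → ℝ) :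
    ∑ S ∈ (∅ᶜ : Finset (PotEdge n)).powerset, F S = ∑ G : SimpleGraph (Fin n), F (edgeSites G) := by
  rw [Finset.compl_empty, Finset.powerset_univ]
  exact (Function.Bijective.sum_comp (edgeSites_bijective n) F).symm

lemma card_edgeSites {n : ℕ} (G : SimpleGraph (Fin n)) : (edgeSites G).card = edgeCount G := by
  rw [edgeCount, edgeSites, ← Fintype.card_subtype, ← Nat.card_eq_fintype_card]
  exact Nat.card_congr ⟨fun e => ⟨e.1.1, e.2⟩,
    fun e => ⟨⟨e.1, G.not_isDiag_of_mem_edgeSet e.2⟩, e.2⟩, fun _ => rfl, fun _ => rfl⟩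

lemma isNClique_three_iff {n : ℕ} (G : SimpleGraph (Fin n)) (s : PotTri n) :
    G.IsNClique 3 s.1 ↔ triEdges n s ⊆ edgeSites G := by
  rw [SimpleGraph.isNClique_iff, and_iff_left s.2, SimpleGraph.isClique_iff]
  constructor
  · intro h e he
    obtain ⟨a, b, hd, hab, rfl⟩ := e.exists_eq
    rw [mem_triEdges] at he
    rw [mem_edgeSites]
    exact h (he a (Sym2.mem_mk_left _ _)) (he b (Sym2.mem_mk_right _ _)) hab
  · intro h a ha b hb hab
    have hm : (⟨s(a, b), by simpa using hab⟩ : PotEdge n) ∈ triEdges n s := by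
      rw [mem_triEdges]
      intro x hx
      rcases Sym2.mem_iff.1 hx with rfl | rfl
      · exact ha
      · exact hb
    exact mem_edgeSites.1 (h hm)

lemma triCount_eq_card {n : ℕ} (G : SimpleGraph (Fin n)) :
    triCount G = (Finset.univ.filter (fun s : PotTri n => triEdges n s ⊆ edgeSites G)).card := by
  rw [triCount, ← Fintype.card_subtype, ← Nat.card_eq_fintype_card]
  exact Nat.card_congr ⟨fun s => ⟨⟨s.1, s.2.2⟩, (isNClique_three_iff G _).1 s.2⟩,
    fun s => ⟨s.1.1, (isNClique_three_iff G _).2 s.2⟩, fun _ => rfl, fun _ => rfl⟩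

lemma card_potEdge (n : ℕ) : Fintype.card (PotEdge n) = n.choose 2 := by
  have := Sym2.card_subtype_not_diag (α := Fin n)
  rw [Fintype.card_fin] at this
  rw [← this]

lemma card_potTri (n : ℕ) : Fintype.card (PotTri n) = n.choose 3 := by
  have := Fintype.card_finset_len (α := Fin n) 3
  rw [Fintype.card_fin] at this
  rw [← this]

lemma edgeCount_le {n : ℕ} (G : SimpleGraph (Fin n)) : edgeCount G ≤ n.choose 2 := by
  rw [← card_edgeSites, ← card_potEdge]
  exact Finset.card_le_univ _

lemma gasWeight_edge_tilt {n : ℕ} (G : SimpleGraph (Fin n)) (lam ζ : ℝ) (k : PotEdge n → ℝ) :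
    gasWeight (triEdges n) (fun e => Real.exp (k e) * lam) (fun _ => ζ) ∅ Finset.univ
      (edgeSites G) = Real.exp (∑ e ∈ edgeSites G, k e) * gibbsWeight lam ζ G := by
  rw [gasWeight, gibbsWeight, Finset.prod_mul_distrib, Finset.prod_const, card_edgeSites,
    Real.exp_sum, Finset.prod_ite, Finset.prod_const, Finset.prod_const_one, mul_one, triCount_eq_card,
    mul_assoc]
  simp only [Finset.union_empty]

lemma gasWeight_triangle_tilt {n : ℕ} (G : SimpleGraph (Fin n)) (lam ζ r : ℝ) :
    gasWeight (triEdges n) (fun _ => lam) (fun _ => 1 - r * (1 - ζ)) ∅ Finset.univ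
      (edgeSites G) = r ^ triCount G * gibbsWeight lam ζ G := by
  rw [gasWeight, gibbsWeight, Finset.prod_const, card_edgeSites, Finset.prod_ite,
    Finset.prod_const, Finset.prod_const_one, mul_one, triCount_eq_card]
  simp only [Finset.union_empty, sub_sub_cancel, mul_pow]
  ring

lemma gasZ_edge_tilt (n : ℕ) (lam ζ : ℝ) (k : PotEdge n → ℝ) :
    gasZ (triEdges n) (fun e => Real.exp (k e) * lam) (fun _ => ζ) ∅ Finset.univ =
      ∑ G : SimpleGraph (Fin n), Real.exp (∑ e ∈ edgeSites G, k e) * gibbsWeight lam ζ G := by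
  rw [gasZ, sum_edgeSites]
  exact Finset.sum_congr rfl fun G _ => gasWeight_edge_tilt G lam ζ k

lemma gasZ_triangle_tilt (n : ℕ) (lam ζ r : ℝ) :
    gasZ (triEdges n) (fun _ => lam) (fun _ => 1 - r * (1 - ζ)) ∅ Finset.univ =
      ∑ G : SimpleGraph (Fin n), r ^ triCount G * gibbsWeight lam ζ G := by
  rw [gasZ, sum_edgeSites]
  exact Finset.sum_congr rfl fun G _ => gasWeight_triangle_tilt G lam ζ r

lemma gasZ_const (n : ℕ) (lam ζ : ℝ) :
    gasZ (triEdges n) (fun _ => lam) (fun _ => ζ) ∅ Finset.univ = Zfun n lam ζ := by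
  have := gasZ_triangle_tilt n lam ζ 1
  simpa [Zfun] using this

lemma gibbsWeight_nonneg {n : ℕ} {lam ζ : ℝ} (hl : 0 ≤ lam) (hζ : ζ ≤ 1)
    (G : SimpleGraph (Fin n)) : 0 ≤ gibbsWeight lam ζ G :=
  mul_nonneg (pow_nonneg hl _) (pow_nonneg (sub_nonneg.2 hζ) _)

/-- The number of ordered pairs in a rectangle which span the edge `e`. -/
def rectMult {n : ℕ} (x y : Fin n → Bool) (e : PotEdge n) : ℝ :=
  ∑ i, ∑ j, if s(i, j) = e.1 ∧ x i = true ∧ y j = true then 1 else 0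

lemma rectMult_nonneg {n : ℕ} (x y : Fin n → Bool) (e : PotEdge n) : 0 ≤ rectMult x y e :=
  Finset.sum_nonneg fun _ _ => Finset.sum_nonneg fun _ _ => by split_ifs <;> norm_num

lemma rectMult_le {n : ℕ} (x y : Fin n → Bool) (e : PotEdge n) : rectMult x y e ≤ 2 := by
  obtain ⟨a, b, h, hab, rfl⟩ := e.exists_eq
  have h1 : rectMult x y ⟨s(a, b), h⟩ ≤
      ∑ i, ∑ j, ((if i = a then (if j = b then (1 : ℝ) else 0) else 0) +
        (if i = b then (if j = a then (1 : ℝ) else 0) else 0)) := by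
    refine Finset.sum_le_sum fun i _ => Finset.sum_le_sum fun j _ => ?_
    split_ifs <;> simp_all
  refine h1.trans (le_of_eq ?_)
  simp only [Finset.sum_add_distrib, Finset.sum_ite_irrel, Finset.sum_ite_eq', Finset.mem_univ,
    if_true, Finset.sum_const_zero]
  norm_num

lemma sum_rectMult {n : ℕ} (x y : Fin n → Bool) (S : Finset (PotEdge n)) :
    ∑ e ∈ S, rectMult x y e = ∑ i, ∑ j, ∑ e ∈ S,
      if s(i, j) = e.1 ∧ x i = true ∧ y j = true then 1 else 0 := by
  simp only [rectMult]
  rw [Finset.sum_comm]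
  exact Finset.sum_congr rfl fun i _ => Finset.sum_comm

lemma sum_rectMult_edgeSites {n : ℕ} (x y : Fin n → Bool) (G : SimpleGraph (Fin n)) :
    ∑ e ∈ edgeSites G, rectMult x y e =
      ∑ i, ∑ j, (if x i then (1 : ℝ) else 0) * adjMat G i j * (if y j then (1 : ℝ) else 0) := by
  rw [sum_rectMult]
  refine Finset.sum_congr rfl fun i _ => Finset.sum_congr rfl fun j _ => ?_
  by_cases h : G.Adj i j
  · rw [Finset.sum_eq_single (⟨s(i, j), by simpa using h.ne⟩ : PotEdge n)]
    · simp only [adjMat, h, if_true, mul_one]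
      by_cases hx : x i = true <;> by_cases hy : y j = true <;> simp [hx, hy]
    · intro e _ he
      rw [if_neg]
      rintro ⟨h1, -⟩
      exact he (Subtype.ext h1.symm)
    · intro h1
      exact (h1 (mem_edgeSites.2 h)).elim
  · rw [Finset.sum_eq_zero]
    · simp [adjMat, h]
    · intro e he
      rw [if_neg]
      rintro ⟨h1, -⟩
      rw [mem_edgeSites, ← h1] at he
      exact h he

lemma sum_rectMult_le {n : ℕ} (x y : Fin n → Bool) :
    ∑ e, rectMult x y e ≤
      ∑ i, ∑ j, (if x i then (1 : ℝ) else 0) * (if y j then (1 : ℝ) else 0) := by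
  have h := sum_rectMult_edgeSites x y (⊤ : SimpleGraph (Fin n))
  have h1 : edgeSites (⊤ : SimpleGraph (Fin n)) = Finset.univ := by
    ext e
    obtain ⟨a, b, hd, hab, rfl⟩ := e.exists_eq
    simp [mem_edgeSites, hab]
  rw [h1] at h
  rw [h]
  refine Finset.sum_le_sum fun i _ => Finset.sum_le_sum fun j _ => ?_
  simp only [adjMat]
  split_ifs <;> norm_num

lemma sum_rect_le {n : ℕ} (x y : Fin n → Bool) :
    ∑ i, ∑ j, (if x i then (1 : ℝ) else 0) * (if y j then (1 : ℝ) else 0) ≤ (n : ℝ) ^ 2 := by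
  have : ∑ i : Fin n, ∑ j : Fin n, (if x i then (1 : ℝ) else 0) * (if y j then (1 : ℝ) else 0) ≤
      ∑ i : Fin n, ∑ j : Fin n, 1 := by
    refine Finset.sum_le_sum fun i _ => Finset.sum_le_sum fun j _ => ?_
    split_ifs <;> norm_num
  refine this.trans (le_of_eq ?_)
  simp [sq]

lemma exists_rect_of_le_cutNorm {n : ℕ} {G : SimpleGraph (Fin n)} {q a : ℝ}
    (h : a ≤ cutNorm (adjMat G - Matrix.of (fun _ _ : Fin n => q))) :
    ∃ x y : Fin n → Bool,
      a + q * ∑ i, ∑ j, (if x i then (1 : ℝ) else 0) * (if y j then (1 : ℝ) else 0) ≤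
        ∑ e ∈ edgeSites G, rectMult x y e := by
  rw [cutNorm] at h
  obtain ⟨x, hx⟩ := exists_eq_ciSup_of_finite (f := fun x : Fin n → Bool =>
    ⨆ y : Fin n → Bool, ∑ i : Fin n, ∑ j : Fin n, (if x i then (1 : ℝ) else 0) *
      (adjMat G - Matrix.of (fun _ _ : Fin n => q)) i j * (if y j then (1 : ℝ) else 0))
  rw [← hx] at h
  obtain ⟨y, hy⟩ := exists_eq_ciSup_of_finite (f := fun y : Fin n → Bool =>
    ∑ i : Fin n, ∑ j : Fin n, (if x i then (1 : ℝ) else 0) *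
      (adjMat G - Matrix.of (fun _ _ : Fin n => q)) i j * (if y j then (1 : ℝ) else 0))
  rw [← hy] at h
  refine ⟨x, y, ?_⟩
  rw [sum_rectMult_edgeSites]
  have h2 : ∑ i : Fin n, ∑ j : Fin n, (if x i then (1 : ℝ) else 0) *
      (adjMat G - Matrix.of (fun _ _ : Fin n => q)) i j * (if y j then (1 : ℝ) else 0) =
      (∑ i, ∑ j, (if x i then (1 : ℝ) else 0) * adjMat G i j * (if y j then (1 : ℝ) else 0)) -
      q * ∑ i, ∑ j, (if x i then (1 : ℝ) else 0) * (if y j then (1 : ℝ) else 0) := by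
    rw [Finset.mul_sum, ← Finset.sum_sub_distrib]
    refine Finset.sum_congr rfl fun i _ => ?_
    rw [Finset.mul_sum, ← Finset.sum_sub_distrib]
    refine Finset.sum_congr rfl fun j _ => ?_
    simp only [Matrix.sub_apply, Matrix.of_apply]
    ring
  linarith

lemma exp_sub_one_le {u : ℝ} (h : |u| ≤ 1) : Real.exp u - 1 ≤ u + u ^ 2 := by
  have := (abs_le.1 (Real.abs_exp_sub_one_sub_id_le h)).2
  linarith

lemma markov_exp {Ω : Type*} [Fintype Ω] {w f : Ω → ℝ} (hw : ∀ ω, 0 ≤ w ω) {E : Ω → Prop} {a : ℝ}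
    (hE : ∀ ω, E ω → a ≤ f ω) :
    ∑ ω, (if E ω then w ω else 0) ≤ Real.exp (-a) * ∑ ω, Real.exp (f ω) * w ω := by
  rw [Finset.mul_sum]
  refine Finset.sum_le_sum fun ω _ => ?_
  rw [← mul_assoc, ← Real.exp_add]
  split_ifs with h
  · refine le_mul_of_one_le_left (hw ω) (Real.one_le_exp ?_)
    linarith [hE ω h]
  · exact mul_nonneg (Real.exp_nonneg _) (hw ω)

lemma nat_div_sqrt (n : ℕ) : (n : ℝ) ^ 2 / Real.sqrt n = n * Real.sqrt n := by
  rw [sq, mul_div_assoc, Real.div_sqrt]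

/-- Chernoff bound for the number of edges in a rectangle. -/
lemma rect_tail {c ζ x ε : ℝ} (hc : 0 < c) (hx : 0 < x) (hε : 0 < ε)
    (hup : OddsUpper c ζ (x + ε * x / 4)) :
    ∃ κ > 0, ∃ τ > 0, ∀ᶠ n : ℕ in atTop, ∀ lam ζ' : ℝ, 0 ≤ lam → |Real.sqrt n * lam - c| ≤ τ →
      0 ≤ ζ' → ζ' ≤ 1 → |ζ' - ζ| ≤ τ → ∀ u v : Fin n → Bool,
      ∑ G : SimpleGraph (Fin n), (if ε * (x / Real.sqrt n) * (n : ℝ) ^ 2 + x / Real.sqrt n *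
          ∑ i, ∑ j, (if u i then (1 : ℝ) else 0) * (if v j then (1 : ℝ) else 0) ≤
          ∑ e ∈ edgeSites G, rectMult u v e then gibbsWeight lam ζ' G else 0) ≤
        Real.exp (-(κ * (n * Real.sqrt n))) * Zfun n lam ζ' := by
  obtain ⟨τ, hτ, hup⟩ := hup 0
  set X := x + ε * x / 4 with hX
  have hX0 : 0 < X := by positivity
  obtain ⟨s, hs0, hs1, hs2, hs3⟩ : ∃ s > 0, 2 * s ≤ 1 ∧ 4 * s * (c + 1) ≤ τ / 2 ∧
      2 * s * X ≤ ε * x / 4 := by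
    refine ⟨min (1 / 2) (min (τ / 2 / (4 * (c + 1))) (ε * x / 4 / (2 * X))), by positivity, ?_, ?_,
      ?_⟩
    · linarith [min_le_left (1 / 2) (min (τ / 2 / (4 * (c + 1))) (ε * x / 4 / (2 * X)))]
    · have := (min_le_right (1 / 2) (min (τ / 2 / (4 * (c + 1))) (ε * x / 4 / (2 * X)))).trans
        (min_le_left _ _)
      rw [le_div_iff₀ (by positivity)] at this
      linarith
    · have := (min_le_right (1 / 2) (min (τ / 2 / (4 * (c + 1))) (ε * x / 4 / (2 * X)))).trans
        (min_le_right _ _)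
      rw [le_div_iff₀ (by positivity)] at this
      linarith
  refine ⟨s * (ε * x / 2), by positivity, min 1 (τ / 2), by positivity, ?_⟩
  filter_upwards [hup] with n hn lam ζ' hl hlc hz0 hz1 hzζ u v
  set K := ∑ i, ∑ j, (if u i then (1 : ℝ) else 0) * (if v j then (1 : ℝ) else 0) with hK
  have hKn : K ≤ (n : ℝ) ^ 2 := sum_rect_le u v
  set q := x / Real.sqrt n with hq
  set M := X / Real.sqrt n with hM
  have hM0 : 0 ≤ M := by positivity
  have hk0 : ∀ e, 0 ≤ rectMult u v e := rectMult_nonneg u v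
  have hk2 : ∀ e, rectMult u v e ≤ 2 := rectMult_le u v
  have hsk : ∀ e, |s * rectMult u v e| ≤ 1 := fun e => by
    rw [abs_of_nonneg (mul_nonneg hs0.le (hk0 e))]
    nlinarith [hk2 e]
  have hmar := markov_exp (w := fun G : SimpleGraph (Fin n) => gibbsWeight lam ζ' G)
    (f := fun G => ∑ e ∈ edgeSites G, s * rectMult u v e)
    (E := fun G => ε * q * (n : ℝ) ^ 2 + q * K ≤ ∑ e ∈ edgeSites G, rectMult u v e)
    (a := s * (ε * q * (n : ℝ) ^ 2 + q * K)) (fun G => gibbsWeight_nonneg hl hz1 G)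
    (fun G hG => by
      rw [← Finset.mul_sum]
      exact mul_le_mul_of_nonneg_left hG hs0.le)
  refine hmar.trans ?_
  rw [← gasZ_edge_tilt n lam ζ' (fun e => s * rectMult u v e)]
  have htilt := gasZ_tilt_le (t := triEdges n) (lam := fun _ => lam) (z := fun _ => ζ')
    (r := fun e => Real.exp (s * rectMult u v e)) hM0
    (fun e => Real.one_le_exp (mul_nonneg hs0.le (hk0 e))) (fun _ => hl) (fun _ => hz1)
    (fun lam' hlam' => by
      refine hn lam' _ ⟨fun e => ⟨hl.trans (hlam' e).1, ?_⟩, fun _ => ⟨hz0, hz1,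
        hzζ.trans ((min_le_right _ _).trans (by linarith))⟩⟩
      have h1 := (hlam' e).1
      have h2 := (hlam' e).2
      have h3 : Real.exp (s * rectMult u v e) ≤ 1 + 4 * s := by
        have h4 := exp_sub_one_le (hsk e)
        have h5 := (abs_le.1 (hsk e)).2
        have h6 := mul_nonneg hs0.le (hk0 e)
        nlinarith [hk2 e]
      have hr := Real.sqrt_nonneg (n : ℝ)
      have hlc' := abs_le.1 hlc
      have hm1 : min 1 (τ / 2) ≤ 1 := min_le_left _ _
      have hm2 : min 1 (τ / 2) ≤ τ / 2 := min_le_right _ _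
      rw [abs_le]
      constructor
      · have := mul_le_mul_of_nonneg_left h1 hr
        linarith
      · have h7 : lam' e ≤ (1 + 4 * s) * lam := h2.trans (mul_le_mul_of_nonneg_right h3 hl)
        have h8 := mul_le_mul_of_nonneg_left h7 hr
        have h9 : 4 * s * (Real.sqrt n * lam) ≤ 4 * s * (c + 1) :=
          mul_le_mul_of_nonneg_left (by linarith) (by linarith)
        nlinarith) Finset.univ
  simp only [Finset.mem_univ, if_true] at htilt
  rw [gasZ_const] at htilt
  refine (mul_le_mul_of_nonneg_left htilt (Real.exp_nonneg _)).trans ?_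
  rw [← mul_assoc, ← Real.exp_add]
  refine mul_le_mul_of_nonneg_right (Real.exp_le_exp.2 ?_)
    (Finset.sum_nonneg fun G _ => gibbsWeight_nonneg hl hz1 G)
  have hsum : ∑ e, rectMult u v e ≤ K := sum_rectMult_le u v
  have hexp : ∑ e, (Real.exp (s * rectMult u v e) - 1) ≤ s * K + 2 * s ^ 2 * (n : ℝ) ^ 2 := by
    calc ∑ e, (Real.exp (s * rectMult u v e) - 1)
        ≤ ∑ e, (s + 2 * s ^ 2) * rectMult u v e := by
          refine Finset.sum_le_sum fun e _ => (exp_sub_one_le (hsk e)).trans ?_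
          have : 0 ≤ s ^ 2 * (rectMult u v e * (2 - rectMult u v e)) :=
            mul_nonneg (sq_nonneg s) (mul_nonneg (hk0 e) (by linarith [hk2 e]))
          nlinarith
      _ = (s + 2 * s ^ 2) * ∑ e, rectMult u v e := by rw [Finset.mul_sum]
      _ ≤ (s + 2 * s ^ 2) * K := mul_le_mul_of_nonneg_left hsum (by positivity)
      _ ≤ _ := by nlinarith [mul_le_mul_of_nonneg_left hKn (sq_nonneg s)]
  rw [← Finset.sum_mul]
  have hr := Real.sqrt_nonneg (n : ℝ)
  have hK0 : 0 ≤ K := (Finset.sum_nonneg fun e _ => hk0 e).trans hsum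
  have h1 := mul_le_mul_of_nonneg_right hexp hM0
  have h2 : -(s * (ε * q * (n : ℝ) ^ 2 + q * K)) + (s * K + 2 * s ^ 2 * (n : ℝ) ^ 2) * M =
      s * (ε * x / 4 * K + 2 * s * X * (n : ℝ) ^ 2 - ε * x * (n : ℝ) ^ 2) / Real.sqrt n := by
    rw [hq, hM, hX]; ring
  have h3 : s * (ε * x / 4 * K + 2 * s * X * (n : ℝ) ^ 2 - ε * x * (n : ℝ) ^ 2) / Real.sqrt n ≤
      s * (-(ε * x / 2) * (n : ℝ) ^ 2) / Real.sqrt n := by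
    refine div_le_div_of_nonneg_right (mul_le_mul_of_nonneg_left ?_ hs0.le) hr
    have h4 : ε * x / 4 * K ≤ ε * x / 4 * (n : ℝ) ^ 2 :=
      mul_le_mul_of_nonneg_left hKn (by positivity)
    have h5 := mul_le_mul_of_nonneg_right hs3 (sq_nonneg (n : ℝ))
    linarith
  have h6 : s * (-(ε * x / 2) * (n : ℝ) ^ 2) / Real.sqrt n =
      -(s * (ε * x / 2) * (n * Real.sqrt n)) := by
    rw [← nat_div_sqrt]; ring
  linarith

lemma tendsto_mul_sqrt : Tendsto (fun n : ℕ => (n : ℝ) * Real.sqrt n) atTop atTop :=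
  tendsto_natCast_atTop_atTop.atTop_mul_atTop₀ tendsto_sqrt_natCast

/-- The cut norm of a sample of the Gibbs measure concentrates, uniformly in the parameters. -/
lemma cutNorm_tail {c ζ x ε : ℝ} (hc : 0 < c) (hx : 0 < x) (hε : 0 < ε)
    (hup : OddsUpper c ζ (x + ε * x / 4)) :
    ∃ κ > 0, ∃ τ > 0, ∀ᶠ n : ℕ in atTop, ∀ lam ζ' : ℝ, 0 ≤ lam → |Real.sqrt n * lam - c| ≤ τ →
      0 ≤ ζ' → ζ' ≤ 1 → |ζ' - ζ| ≤ τ →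
      ∑ G : SimpleGraph (Fin n), (if ε * (x / Real.sqrt n) * (n : ℝ) ^ 2 ≤
          cutNorm (adjMat G - Matrix.of (fun _ _ : Fin n => x / Real.sqrt n))
          then gibbsWeight lam ζ' G else 0) ≤
        Real.exp (-(κ * (n * Real.sqrt n))) * Zfun n lam ζ' := by
  obtain ⟨κ, hκ, τ, hτ, h⟩ := rect_tail hc hx hε hup
  refine ⟨κ / 2, by positivity, τ, hτ, ?_⟩
  filter_upwards [h, tendsto_sqrt_natCast.eventually_ge_atTop (2 * Real.log 4 / κ)]
    with n hn hns lam ζ' hl hlc hz0 hz1 hzζ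
  have hw := fun G : SimpleGraph (Fin n) => gibbsWeight_nonneg hl hz1 G
  have hZ : 0 ≤ Zfun n lam ζ' := Finset.sum_nonneg fun G _ => hw G
  have h1 : ∑ G : SimpleGraph (Fin n), (if ε * (x / Real.sqrt n) * (n : ℝ) ^ 2 ≤
        cutNorm (adjMat G - Matrix.of (fun _ _ : Fin n => x / Real.sqrt n))
        then gibbsWeight lam ζ' G else 0) ≤
      ∑ G : SimpleGraph (Fin n), ∑ u : Fin n → Bool, ∑ v : Fin n → Bool,
        (if ε * (x / Real.sqrt n) * (n : ℝ) ^ 2 + x / Real.sqrt n *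
          ∑ i, ∑ j, (if u i then (1 : ℝ) else 0) * (if v j then (1 : ℝ) else 0) ≤
          ∑ e ∈ edgeSites G, rectMult u v e then gibbsWeight lam ζ' G else 0) := by
    refine Finset.sum_le_sum fun G _ => ?_
    have hnn : ∀ u v : Fin n → Bool, 0 ≤ (if ε * (x / Real.sqrt n) * (n : ℝ) ^ 2 + x / Real.sqrt n *
          ∑ i, ∑ j, (if u i then (1 : ℝ) else 0) * (if v j then (1 : ℝ) else 0) ≤
          ∑ e ∈ edgeSites G, rectMult u v e then gibbsWeight lam ζ' G else 0) := fun u v => by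
      split_ifs
      · exact hw G
      · exact le_rfl
    split_ifs with hG
    · obtain ⟨u, v, huv⟩ := exists_rect_of_le_cutNorm hG
      refine le_trans ?_ (Finset.single_le_sum
        (fun u _ => Finset.sum_nonneg fun v _ => hnn u v) (Finset.mem_univ u))
      refine le_trans ?_ (Finset.single_le_sum (fun v _ => hnn u v) (Finset.mem_univ v))
      rw [if_pos huv]
    · exact Finset.sum_nonneg fun u _ => Finset.sum_nonneg fun v _ => hnn u v
  refine h1.trans ?_
  rw [Finset.sum_comm]
  calc _ ≤ ∑ _u : Fin n → Bool, ∑ _v : Fin n → Bool,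
        Real.exp (-(κ * (n * Real.sqrt n))) * Zfun n lam ζ' := by
        refine Finset.sum_le_sum fun u _ => ?_
        rw [Finset.sum_comm]
        exact Finset.sum_le_sum fun v _ => hn lam ζ' hl hlc hz0 hz1 hzζ u v
    _ = Real.exp (n * Real.log 4) * (Real.exp (-(κ * (n * Real.sqrt n))) * Zfun n lam ζ') := by
        rw [Finset.sum_const, Finset.sum_const, smul_smul, nsmul_eq_mul, Real.exp_nat_mul,
          Real.exp_log (by norm_num)]
        congr 1
        simp only [Finset.card_univ, Fintype.card_fun, Fintype.card_bool, Fintype.card_fin]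
        push_cast
        rw [← mul_pow]
        norm_num
    _ ≤ _ := by
        rw [← mul_assoc, ← Real.exp_add]
        refine mul_le_mul_of_nonneg_right (Real.exp_le_exp.2 ?_) hZ
        rw [div_le_iff₀ hκ] at hns
        have := mul_le_mul_of_nonneg_left hns (Nat.cast_nonneg (α := ℝ) n)
        nlinarith

lemma tendsto_choose_three_div :
    Tendsto (fun n : ℕ => (n.choose 3 : ℝ) / (n : ℝ) ^ 3) atTop (nhds (1 / 6)) := by
  have h : Tendsto (fun n : ℕ => ((n - 2 : ℕ) : ℝ) / n * (((n - 1 : ℕ) : ℝ) / n *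
      (((n - 0 : ℕ) : ℝ) / n)) / 6) atTop (nhds (1 * (1 * 1) / 6)) :=
    ((tendsto_natSub_div 2).mul ((tendsto_natSub_div 1).mul (tendsto_natSub_div 0))).div_const 6
  norm_num only at h
  refine h.congr fun n => ?_
  have h1 := Nat.descFactorial_eq_factorial_mul_choose n 3
  have h2 : ((n - 2 : ℕ) : ℝ) * (((n - 1 : ℕ) : ℝ) * ((n : ℕ) : ℝ)) = 6 * (n.choose 3 : ℝ) := by
    have h3 : (n - 2) * ((n - 1) * n) = 6 * n.choose 3 := by
      simpa [Nat.descFactorial, Nat.factorial] using h1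
    exact_mod_cast h3
  have h4 : (n.choose 3 : ℝ) = ((n - 2 : ℕ) : ℝ) * (((n - 1 : ℕ) : ℝ) * ((n : ℕ) : ℝ)) / 6 := by
    rw [h2]; ring
  rw [h4, Nat.sub_zero]
  ring

lemma sqrt_pow_three (n : ℕ) : Real.sqrt n ^ 3 = n * Real.sqrt n := by
  rw [pow_succ, Real.sq_sqrt (Nat.cast_nonneg n)]

lemma mul_sqrt_mul_sqrt_pow (n : ℕ) : (n * Real.sqrt n) * Real.sqrt n ^ 3 = (n : ℝ) ^ 3 := by
  rw [sqrt_pow_three, mul_mul_mul_comm, Real.mul_self_sqrt (Nat.cast_nonneg n)]; ring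

lemma choose_three_mul_le {X : ℝ} (hX : 0 ≤ X) {n : ℕ} (hn : 0 < n) :
    (n.choose 3 : ℝ) * (X / Real.sqrt n) ^ 3 ≤ X ^ 3 / 6 * (n * Real.sqrt n) := by
  have h1 : (n.choose 3 : ℝ) ≤ (n : ℝ) ^ 3 / 6 := by
    simpa [Nat.factorial] using Nat.choose_le_pow_div (α := ℝ) 3 n
  have hs : 0 < Real.sqrt n := Real.sqrt_pos.2 (by exact_mod_cast hn)
  calc _ ≤ (n : ℝ) ^ 3 / 6 * (X / Real.sqrt n) ^ 3 :=
        mul_le_mul_of_nonneg_right h1 (by positivity)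
    _ = _ := by
      rw [← mul_sqrt_mul_sqrt_pow, div_pow]
      field_simp

lemma tendsto_choose_three_mul (Y : ℝ) :
    Tendsto (fun n : ℕ => (n.choose 3 : ℝ) * (Y / Real.sqrt n / (1 + Y / Real.sqrt n)) ^ 3 /
      (n * Real.sqrt n)) atTop (nhds (Y ^ 3 / 6)) := by
  have h : Tendsto (fun n : ℕ => (n.choose 3 : ℝ) / (n : ℝ) ^ 3 *
      (Y / (1 + Y / Real.sqrt n)) ^ 3) atTop (nhds (1 / 6 * (Y / (1 + 0)) ^ 3)) :=
    tendsto_choose_three_div.mul ((Tendsto.div tendsto_const_nhds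
      (tendsto_const_nhds.add (tendsto_div_sqrt_natCast Y)) (by norm_num)).pow 3)
  have h0 : 1 / 6 * (Y / (1 + 0)) ^ 3 = Y ^ 3 / 6 := by ring
  rw [h0] at h
  refine h.congr' ?_
  filter_upwards [eventually_gt_atTop 0] with n hn
  have hs : 0 < Real.sqrt n := Real.sqrt_pos.2 (by exact_mod_cast hn)
  rw [← mul_sqrt_mul_sqrt_pow, div_right_comm, div_pow (Y / (1 + Y / Real.sqrt n))]
  field_simp

/-- Moment generating function of the number of triangles. -/
lemma triangle_mgf_le {c ζ X Y : ℝ} (hζ0 : 0 < ζ) (hζ1 : ζ < 1) (hX : 0 ≤ X) (hY : 0 ≤ Y)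
    (hup : OddsUpper c ζ X) (hlo : OddsLower c ζ Y) :
    ∃ s₀ > 0, ∃ τ > 0, ∀ᶠ n : ℕ in atTop, ∀ lam : ℝ, 0 ≤ lam → |Real.sqrt n * lam - c| ≤ τ →
      ∀ s, 0 < s → s ≤ s₀ →
      (∑ G : SimpleGraph (Fin n), Real.exp (s * triCount G) * gibbsWeight lam ζ G ≤
        Real.exp ((Real.exp s - 1) * (1 - ζ) * (n.choose 3 * (X / Real.sqrt n) ^ 3)) *
          Zfun n lam ζ) ∧
      (∑ G : SimpleGraph (Fin n), Real.exp (-s * triCount G) * gibbsWeight lam ζ G ≤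
        Real.exp ((Real.exp (-s) - 1) * (1 - ζ) *
          (n.choose 3 * (Y / Real.sqrt n / (1 + Y / Real.sqrt n)) ^ 3)) * Zfun n lam ζ) := by
  obtain ⟨τ₁, hτ₁, hup⟩ := hup 2
  obtain ⟨τ₂, hτ₂, hlo⟩ := hlo 2
  refine ⟨min (1 / 2) (min (ζ / 2) (min (τ₁ / 2) (τ₂ / 2))), by positivity, min τ₁ τ₂, by positivity,
    ?_⟩
  filter_upwards [hup, hlo] with n hn₁ hn₂ lam hl hlc s hs0 hs
  have hs1 : 2 * s ≤ 1 := by linarith [hs.trans (min_le_left _ _)]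
  have hs' := hs.trans (min_le_right _ _)
  have hs2 : 2 * s ≤ ζ := by linarith [hs'.trans (min_le_left _ _)]
  have hs'' := hs'.trans (min_le_right _ _)
  have hs3 : 2 * s ≤ τ₁ := by linarith [hs''.trans (min_le_left _ _)]
  have hs4 : 2 * s ≤ τ₂ := by linarith [hs''.trans (min_le_right _ _)]
  have key : ∀ σ : ℝ, |σ| = s → ∀ z' : PotTri n → ℝ,
      (∀ i, z' i = ζ ∨ z' i = 1 - Real.exp σ * (1 - ζ)) →
      ∀ i, 0 ≤ z' i ∧ z' i ≤ 1 ∧ |z' i - ζ| ≤ 2 * s := by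
    intro σ hσ z' hz' i
    have h1 := Real.abs_exp_sub_one_le (x := σ) (by rw [hσ]; linarith)
    rw [hσ] at h1
    have h2 : |(1 - Real.exp σ * (1 - ζ)) - ζ| ≤ 2 * s := by
      have : (1 - Real.exp σ * (1 - ζ)) - ζ = (1 - ζ) * (1 - Real.exp σ) := by ring
      rw [this, abs_mul, abs_of_pos (sub_pos.2 hζ1), abs_sub_comm]
      nlinarith [abs_nonneg (Real.exp σ - 1)]
    rcases hz' i with h | h
    · rw [h, sub_self, abs_zero]
      exact ⟨hζ0.le, hζ1.le, by linarith⟩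
    · rw [h]
      refine ⟨?_, ?_, h2⟩
      · linarith [(abs_le.1 h2).1]
      · have := mul_nonneg (Real.exp_nonneg σ) (sub_pos.2 hζ1).le
        linarith
  have tilt : ∀ σ T : ℝ, (∀ z' : PotTri n → ℝ,
      (∀ i, z' i = ζ ∨ z' i = 1 - Real.exp σ * (1 - ζ)) → ∀ i,
      (Real.exp σ - 1) * gasSat (triEdges n) (fun _ => lam) z' ∅ (Finset.univ.erase i) i ≤
        (Real.exp σ - 1) * T * gasZ (triEdges n) (fun _ => lam) z' ∅ Finset.univ) →
      ∑ G : SimpleGraph (Fin n), Real.exp (σ * triCount G) * gibbsWeight lam ζ G ≤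
        Real.exp ((Real.exp σ - 1) * (1 - ζ) * (n.choose 3 * T)) * Zfun n lam ζ := by
    intro σ T h
    have := gasZ_constraint_tilt_le (t := triEdges n) (lam := fun _ => lam) (z := fun _ => ζ)
      (r := Real.exp σ) (T := T) (fun _ => hl) (fun _ => hζ1.le) (Real.exp_nonneg _) h Finset.univ
    simp only [Finset.mem_univ, if_true, Finset.sum_const, nsmul_eq_mul, Finset.card_univ,
      card_potTri] at this
    rw [gasZ_triangle_tilt, gasZ_const] at this
    have h1 : ∀ G : SimpleGraph (Fin n), Real.exp (σ * triCount G) = Real.exp σ ^ triCount G :=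
      fun G => by rw [mul_comm σ, Real.exp_nat_mul]
    simp only [h1]
    refine this.trans (le_of_eq ?_)
    ring_nf
  have hX' : 0 ≤ X / Real.sqrt n := by positivity
  have hY' : 0 ≤ Y / Real.sqrt n := by positivity
  constructor
  · refine tilt s _ fun z' hz' i => ?_
    have hk := key s (abs_of_pos hs0) z' hz'
    rw [mul_assoc]
    refine mul_le_mul_of_nonneg_left ?_ (sub_nonneg.2 (Real.one_le_exp hs0.le))
    refine OddsLE.gasSat_le card_triEdges hX' (fun _ => hl) (fun i => (hk i).2.1) ?_ i
    exact hn₁ _ _ ⟨fun _ => ⟨hl, hlc.trans (min_le_left _ _)⟩,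
      fun i => ⟨(hk i).1, (hk i).2.1, (hk i).2.2.trans hs3⟩⟩
  · refine tilt (-s) _ fun z' hz' i => ?_
    have hk := key (-s) (by rw [abs_neg, abs_of_pos hs0]) z' hz'
    rw [mul_assoc]
    refine mul_le_mul_of_nonpos_left ?_ (sub_nonpos.2 (Real.exp_le_one_iff.2 (by linarith)))
    refine OddsGE.le_gasSat card_triEdges (isLinearFamily_triEdges n) hY' (fun _ => hl)
      (fun i => (hk i).1) (fun i => (hk i).2.1) ?_ i
    exact hn₂ _ _ ⟨fun _ => ⟨hl, hlc.trans (min_le_right _ _)⟩,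
      fun i => ⟨(hk i).1, (hk i).2.1, (hk i).2.2.trans hs4⟩⟩

/-- The number of triangles of a sample of the Gibbs measure concentrates. -/
lemma triCount_window {c ζ x δ : ℝ} (hζ0 : 0 < ζ) (hζ1 : ζ < 1) (hx : 0 < x) (hδ : 0 < δ)
    (h : ∀ δ > 0, OddsUpper c ζ (x + δ) ∧ OddsLower c ζ (max 0 (x - δ))) :
    ∃ τ > 0, ∀ᶠ n : ℕ in atTop, ∀ lam : ℝ, 0 ≤ lam → |Real.sqrt n * lam - c| ≤ τ →
      Zfun n lam ζ / 2 ≤ ∑ G : SimpleGraph (Fin n),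
        if |(triCount G : ℝ) - (1 - ζ) * x ^ 3 / 6 * (n * Real.sqrt n)| ≤ δ * (n * Real.sqrt n)
          then gibbsWeight lam ζ G else 0 := by
  set a := (1 - ζ) * x ^ 3 / 6 with ha
  have hz : 0 < 1 - ζ := sub_pos.2 hζ1
  have ha0 : 0 < a := by positivity
  obtain ⟨d, hd0, hd1, hd2⟩ : ∃ d > 0, (1 - ζ) * ((x + d) ^ 3 / 6) < a + δ / 2 ∧
      a - δ / 2 < (1 - ζ) * ((max 0 (x - d)) ^ 3 / 6) := by
    have h1 : Tendsto (fun d : ℝ => (1 - ζ) * ((x + d) ^ 3 / 6)) (nhds 0)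
        (nhds ((1 - ζ) * ((x + 0) ^ 3 / 6))) := Continuous.tendsto (by fun_prop) _
    have h2 : Tendsto (fun d : ℝ => (1 - ζ) * ((max 0 (x - d)) ^ 3 / 6)) (nhds 0)
        (nhds ((1 - ζ) * ((max 0 (x - 0)) ^ 3 / 6))) := Continuous.tendsto (by fun_prop) _
    rw [sub_zero, max_eq_right hx.le, ← mul_div_assoc, ← ha] at h2
    rw [add_zero, ← mul_div_assoc, ← ha] at h1
    have h3 := ((h1.eventually (gt_mem_nhds (show a < a + δ / 2 by linarith))).and
      (h2.eventually (lt_mem_nhds (show a - δ / 2 < a by linarith)))).filter_mono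
      (nhdsWithin_le_nhds (s := Set.Ioi 0))
    obtain ⟨d, h4, h5⟩ := (h3.and self_mem_nhdsWithin).exists
    exact ⟨d, h5, h4.1, h4.2⟩
  obtain ⟨s₀, hs₀, τ, hτ, hm⟩ := triangle_mgf_le hζ0 hζ1 (by positivity) (le_max_left _ _)
    (h d hd0).1 (h d hd0).2
  obtain ⟨s, hs0, hs1, hs2, hs3⟩ : ∃ s > 0, s ≤ s₀ ∧ s ≤ 1 ∧ s * (a + δ / 2) ≤ δ / 4 := by
    refine ⟨min s₀ (min 1 (δ / 4 / (a + δ / 2))), by positivity, min_le_left _ _,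
      (min_le_right _ _).trans (min_le_left _ _), ?_⟩
    have := (min_le_right s₀ _).trans (min_le_right 1 (δ / 4 / (a + δ / 2)))
    rwa [le_div_iff₀ (by positivity)] at this
  refine ⟨τ, hτ, ?_⟩
  have hlim := ((tendsto_choose_three_mul (max 0 (x - d))).const_mul (1 - ζ)).eventually
    (lt_mem_nhds hd2)
  filter_upwards [hm, hlim, eventually_gt_atTop 0,
    tendsto_mul_sqrt.eventually_ge_atTop (Real.log 4 / (s * δ / 4))] with n hn hlo hn0 hbig lam hl hlc
  obtain ⟨hU, hL⟩ := hn lam hl hlc s hs0 hs1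
  have hsq : 0 < Real.sqrt n := Real.sqrt_pos.2 (by exact_mod_cast hn0)
  have hR : 0 < (n : ℝ) * Real.sqrt n := mul_pos (by exact_mod_cast hn0) hsq
  set R := (n : ℝ) * Real.sqrt n with hRdef
  have hw := fun G : SimpleGraph (Fin n) => gibbsWeight_nonneg hl hζ1.le G
  have hZ : 0 ≤ Zfun n lam ζ := Finset.sum_nonneg fun G _ => hw G
  have hquarter : Real.exp (-(s * δ / 4 * R)) ≤ 1 / 4 := by
    rw [div_le_iff₀ (by positivity)] at hbig
    have h1 : Real.exp (-(s * δ / 4 * R)) ≤ Real.exp (-Real.log 4) :=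
      Real.exp_le_exp.2 (by linarith)
    rwa [Real.exp_neg, Real.exp_neg, Real.exp_log (by norm_num), ← one_div (4 : ℝ),
      ← Real.exp_neg] at h1
  have hs_abs : |s| ≤ 1 := by rwa [abs_of_pos hs0]
  have hupper : ∑ G : SimpleGraph (Fin n), (if (a + δ) * R ≤ (triCount G : ℝ)
      then gibbsWeight lam ζ G else 0) ≤ 1 / 4 * Zfun n lam ζ := by
    refine (markov_exp (f := fun G => s * (triCount G : ℝ)) (a := s * ((a + δ) * R)) hw
      fun G hG => mul_le_mul_of_nonneg_left hG hs0.le).trans ?_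
    refine (mul_le_mul_of_nonneg_left hU (Real.exp_nonneg _)).trans ?_
    rw [← mul_assoc, ← Real.exp_add]
    refine mul_le_mul_of_nonneg_right (le_trans (Real.exp_le_exp.2 ?_) hquarter) hZ
    have h1 : (1 - ζ) * (n.choose 3 * ((x + d) / Real.sqrt n) ^ 3) ≤ (a + δ / 2) * R := by
      have h2 := mul_le_mul_of_nonneg_left
        (choose_three_mul_le (show 0 ≤ x + d by positivity) hn0) hz.le
      have h3 := mul_le_mul_of_nonneg_right hd1.le hR.le
      linarith
    have h4 : Real.exp s - 1 ≤ s + s ^ 2 := exp_sub_one_le hs_abs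
    have h5 : (Real.exp s - 1) * ((1 - ζ) * (n.choose 3 * ((x + d) / Real.sqrt n) ^ 3)) ≤
        (s + s ^ 2) * ((a + δ / 2) * R) :=
      mul_le_mul h4 h1 (by positivity) (by positivity)
    have h6 := mul_le_mul_of_nonneg_right hs3 (mul_nonneg hs0.le hR.le)
    linarith
  have hlower : ∑ G : SimpleGraph (Fin n), (if (triCount G : ℝ) ≤ (a - δ) * R
      then gibbsWeight lam ζ G else 0) ≤ 1 / 4 * Zfun n lam ζ := by
    refine (markov_exp (f := fun G => -s * (triCount G : ℝ)) (a := -s * ((a - δ) * R)) hw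
      fun G hG => mul_le_mul_of_nonpos_left hG (by linarith)).trans ?_
    refine (mul_le_mul_of_nonneg_left hL (Real.exp_nonneg _)).trans ?_
    rw [← mul_assoc, ← Real.exp_add]
    refine mul_le_mul_of_nonneg_right (le_trans (Real.exp_le_exp.2 ?_) hquarter) hZ
    set N := (n.choose 3 : ℝ) * (max 0 (x - d) / Real.sqrt n /
      (1 + max 0 (x - d) / Real.sqrt n)) ^ 3 with hN
    have hN0 : 0 ≤ N := by
      have : 0 ≤ max 0 (x - d) := le_max_left _ _
      positivity
    have h1 : (a - δ / 2) * R ≤ (1 - ζ) * N := by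
      rw [← mul_div_assoc] at hlo
      exact ((lt_div_iff₀ hR).1 hlo).le
    have h4 : Real.exp (-s) - 1 ≤ -s + s ^ 2 := by
      have := exp_sub_one_le (u := -s) (by rwa [abs_neg])
      rwa [neg_sq] at this
    have h5 : (Real.exp (-s) - 1) * ((1 - ζ) * N) ≤ (-s + s ^ 2) * ((1 - ζ) * N) :=
      mul_le_mul_of_nonneg_right h4 (by positivity)
    have h6 : (-s + s ^ 2) * ((1 - ζ) * N) ≤ (-s + s ^ 2) * ((a - δ / 2) * R) :=
      mul_le_mul_of_nonpos_left h1 (by nlinarith)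
    have h7 := mul_le_mul_of_nonneg_right hs3 (mul_nonneg hs0.le hR.le)
    have h8 : 0 ≤ s ^ 2 * (δ * R) := by positivity
    linarith
  have hsplit : Zfun n lam ζ ≤ ∑ G : SimpleGraph (Fin n),
      ((if |(triCount G : ℝ) - a * R| ≤ δ * R then gibbsWeight lam ζ G else 0) +
      (if (a + δ) * R ≤ (triCount G : ℝ) then gibbsWeight lam ζ G else 0) +
      (if (triCount G : ℝ) ≤ (a - δ) * R then gibbsWeight lam ζ G else 0)) := by
    refine Finset.sum_le_sum fun G _ => ?_
    have := hw G
    by_cases h1 : |(triCount G : ℝ) - a * R| ≤ δ * R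
    · rw [if_pos h1]
      split_ifs <;> linarith
    · rw [abs_le, not_and_or, not_le, not_le] at h1
      rcases h1 with h1 | h1
      · rw [if_pos (show (triCount G : ℝ) ≤ (a - δ) * R by linarith)]
        split_ifs <;> linarith
      · rw [if_pos (show (a + δ) * R ≤ (triCount G : ℝ) by linarith)]
        split_ifs <;> linarith
  rw [Finset.sum_add_distrib, Finset.sum_add_distrib] at hsplit
  linarith

lemma erProb_eq {n : ℕ} {p : ℝ} (hp : p < 1) (A : Set (SimpleGraph (Fin n))) :
    erProb n p A = (1 - p) ^ n.choose 2 *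
      ∑ G : SimpleGraph (Fin n), if G ∈ A then (p / (1 - p)) ^ edgeCount G else 0 := by
  rw [erProb, Finset.mul_sum]
  refine Finset.sum_congr rfl fun G _ => ?_
  split_ifs
  · have h : (1 - p) ^ n.choose 2 =
        (1 - p) ^ (n.choose 2 - edgeCount G) * (1 - p) ^ edgeCount G := by
      rw [← pow_add, Nat.sub_add_cancel (edgeCount_le G)]
    have h1 : (1 - p) ^ edgeCount G ≠ 0 := pow_ne_zero _ (by linarith)
    rw [h, div_pow]
    field_simp
  · rw [mul_zero]

lemma erCondProb_eq {n : ℕ} {p : ℝ} (hp : p < 1) (A B : Set (SimpleGraph (Fin n))) :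
    erCondProb n p A B =
      (∑ G : SimpleGraph (Fin n), if G ∈ A ∩ B then (p / (1 - p)) ^ edgeCount G else 0) /
        ∑ G : SimpleGraph (Fin n), if G ∈ B then (p / (1 - p)) ^ edgeCount G else 0 := by
  rw [erCondProb, erProb_eq hp, erProb_eq hp]
  convert mul_div_mul_left _ _ (pow_ne_zero (n.choose 2) (sub_pos.2 hp).ne')

lemma erCondProb_nonneg {n : ℕ} {p : ℝ} (hp : p ∈ Set.Ioo (0 : ℝ) 1)
    (A B : Set (SimpleGraph (Fin n))) : 0 ≤ erCondProb n p A B := by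
  have h : 0 ≤ p / (1 - p) := div_nonneg hp.1.le (by linarith [hp.2])
  rw [erCondProb_eq hp.2]
  refine div_nonneg (Finset.sum_nonneg fun G _ => ?_) (Finset.sum_nonneg fun G _ => ?_) <;>
  · split_ifs
    · exact pow_nonneg h _
    · exact le_rfl

/-- Conditioning on having no triangles is the hard-core Gibbs measure. -/
lemma erCondProb_le_of_hardcore {n : ℕ} {p b : ℝ} (hp : p ∈ Set.Ioo (0 : ℝ) 1) (hb : 0 ≤ b)
    {A : Set (SimpleGraph (Fin n))}
    (h : ∑ G : SimpleGraph (Fin n), (if G ∈ A then gibbsWeight (p / (1 - p)) 1 G else 0) ≤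
      b * Zfun n (p / (1 - p)) 1) :
    erCondProb n p A {G | (triCount G : ℝ) ≤ 0} ≤ b := by
  have hl : 0 ≤ p / (1 - p) := div_nonneg hp.1.le (by linarith [hp.2])
  have hB : ∀ G : SimpleGraph (Fin n), G ∈ {G : SimpleGraph (Fin n) | (triCount G : ℝ) ≤ 0} ↔
      triCount G = 0 := fun G => by
    rw [Set.mem_ofPred_eq, Nat.cast_nonpos]
  have hg : ∀ G : SimpleGraph (Fin n), gibbsWeight (p / (1 - p)) 1 G =
      if triCount G = 0 then (p / (1 - p)) ^ edgeCount G else 0 := fun G => by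
    rw [gibbsWeight, sub_self]
    split_ifs with h0
    · rw [h0, pow_zero, mul_one]
    · rw [zero_pow h0, mul_zero]
  rw [erCondProb_eq hp.2]
  refine div_le_of_le_mul₀ (Finset.sum_nonneg fun G _ => ?_) hb ?_
  · split_ifs
    · exact pow_nonneg hl _
    · exact le_rfl
  · simp only [hg, Zfun, Set.mem_inter_iff, hB, ite_and] at h ⊢
    exact h

/-- Comparison of the conditioned measure with the Gibbs measure, when the latter puts at least
half of its mass on a window of triangle counts just below the conditioning threshold. -/
lemma erCondProb_le_of_window {n : ℕ} {p b L H w a δ : ℝ} (hp : p ∈ Set.Ioo (0 : ℝ) 1) (hb : 0 ≤ b)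
    (hL : 0 ≤ L) (hup : a + δ ≤ H) (hlo : H - w ≤ a - δ) {A : Set (SimpleGraph (Fin n))}
    (hA : ∑ G : SimpleGraph (Fin n), (if G ∈ A then
      gibbsWeight (p / (1 - p)) (1 - Real.exp (-L)) G else 0) ≤
        b * Zfun n (p / (1 - p)) (1 - Real.exp (-L)))
    (hwin : Zfun n (p / (1 - p)) (1 - Real.exp (-L)) / 2 ≤ ∑ G : SimpleGraph (Fin n),
      if |(triCount G : ℝ) - a| ≤ δ then gibbsWeight (p / (1 - p)) (1 - Real.exp (-L)) G else 0) :
    erCondProb n p A {G | (triCount G : ℝ) ≤ H} ≤ 2 * (Real.exp (L * w) * b) := by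
  set lam := p / (1 - p) with hlam
  have hl : 0 ≤ lam := div_nonneg hp.1.le (by linarith [hp.2])
  set Z := Zfun n lam (1 - Real.exp (-L)) with hZdef
  have hg : ∀ G : SimpleGraph (Fin n), gibbsWeight lam (1 - Real.exp (-L)) G =
      lam ^ edgeCount G * Real.exp (-(L * triCount G)) := fun G => by
    rw [gibbsWeight, sub_sub_cancel, ← Real.exp_nat_mul]
    congr 2; ring
  have hgi : ∀ G : SimpleGraph (Fin n), lam ^ edgeCount G =
      Real.exp (L * triCount G) * gibbsWeight lam (1 - Real.exp (-L)) G := fun G => by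
    rw [hg, mul_left_comm, ← Real.exp_add, add_neg_cancel, Real.exp_zero, mul_one]
  have hw0 : ∀ G : SimpleGraph (Fin n), 0 ≤ gibbsWeight lam (1 - Real.exp (-L)) G :=
    fun G => gibbsWeight_nonneg hl (by linarith [Real.exp_pos (-L)]) G
  have hnum : (∑ G : SimpleGraph (Fin n), if G ∈ A ∩ {G | (triCount G : ℝ) ≤ H} then
      lam ^ edgeCount G else 0) ≤ Real.exp (L * H) * (b * Z) := by
    refine le_trans ?_ (mul_le_mul_of_nonneg_left hA (Real.exp_nonneg _))
    rw [Finset.mul_sum]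
    refine Finset.sum_le_sum fun G _ => ?_
    by_cases h1 : G ∈ A
    · rw [if_pos h1]
      split_ifs with h2
      · rw [hgi]
        exact mul_le_mul_of_nonneg_right
          (Real.exp_le_exp.2 (mul_le_mul_of_nonneg_left h2.2 hL)) (hw0 G)
      · exact mul_nonneg (Real.exp_nonneg _) (hw0 G)
    · rw [if_neg h1, if_neg fun h2 => h1 h2.1, mul_zero]
  have hden : Real.exp (L * (H - w)) * (Z / 2) ≤ ∑ G : SimpleGraph (Fin n),
      if G ∈ {G | (triCount G : ℝ) ≤ H} then lam ^ edgeCount G else 0 := by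
    refine (mul_le_mul_of_nonneg_left hwin (Real.exp_nonneg _)).trans ?_
    rw [Finset.mul_sum]
    refine Finset.sum_le_sum fun G _ => ?_
    by_cases h1 : |(triCount G : ℝ) - a| ≤ δ
    · have h2 := abs_le.1 h1
      rw [if_pos h1, if_pos (show G ∈ {G : SimpleGraph (Fin n) | (triCount G : ℝ) ≤ H} by
        rw [Set.mem_ofPred_eq]; linarith), hgi]
      exact mul_le_mul_of_nonneg_right
        (Real.exp_le_exp.2 (mul_le_mul_of_nonneg_left (by linarith) hL)) (hw0 G)
    · rw [if_neg h1, mul_zero]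
      split_ifs
      · exact pow_nonneg hl _
      · exact le_rfl
  rw [erCondProb_eq hp.2]
  refine div_le_of_le_mul₀ (Finset.sum_nonneg fun G _ => ?_) (by positivity) ?_
  · split_ifs
    · exact pow_nonneg hl _
    · exact le_rfl
  · refine hnum.trans ?_
    refine le_trans (le_of_eq ?_) (mul_le_mul_of_nonneg_left hden
      (show 0 ≤ 2 * (Real.exp (L * w) * b) by positivity))
    have : Real.exp (L * H) = Real.exp (L * w) * Real.exp (L * (H - w)) := by
      rw [← Real.exp_add]; ring_nf
    rw [this]; ring

lemma tendsto_sqrt_mul_odds {p : ℕ → ℝ} {c : ℝ}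
    (hpc : Tendsto (fun n : ℕ => Real.sqrt n * p n) atTop (nhds c)) :
    Tendsto (fun n : ℕ => Real.sqrt n * (p n / (1 - p n))) atTop (nhds c) := by
  have h0 : Tendsto p atTop (nhds 0) := by
    have h := hpc.mul (tendsto_div_sqrt_natCast 1)
    rw [mul_zero] at h
    refine h.congr' ?_
    filter_upwards [eventually_gt_atTop 0] with n hn
    have hs : 0 < Real.sqrt n := Real.sqrt_pos.2 (by exact_mod_cast hn)
    field_simp
  have h1 := hpc.div (tendsto_const_nhds.sub h0 : Tendsto (fun n => 1 - p n) atTop (nhds (1 - 0)))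
    (by norm_num)
  rw [sub_zero, div_one] at h1
  refine h1.congr fun n => ?_
  simp only [Pi.div_apply]
  ring

lemma tendsto_threshold {p : ℕ → ℝ} {c : ℝ} (η : ℝ)
    (hpc : Tendsto (fun n : ℕ => Real.sqrt n * p n) atTop (nhds c)) :
    Tendsto (fun n : ℕ => η * (n.choose 3 : ℝ) * p n ^ 3 / (n * Real.sqrt n)) atTop
      (nhds (η * c ^ 3 / 6)) := by
  have h := (tendsto_choose_three_div.mul (hpc.pow 3)).const_mul η
  have h0 : η * (1 / 6 * c ^ 3) = η * c ^ 3 / 6 := by ring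
  rw [h0] at h
  refine h.congr' ?_
  filter_upwards [eventually_gt_atTop 0] with n hn
  have hs : 0 < Real.sqrt n := Real.sqrt_pos.2 (by exact_mod_cast hn)
  rw [← mul_sqrt_mul_sqrt_pow]
  field_simp

lemma summable_of_le_exp {f : ℕ → ℝ} {κ : ℝ} (hκ : 0 < κ) (h0 : ∀ n, 0 ≤ f n)
    (h : ∀ᶠ n : ℕ in atTop, f n ≤ 2 * Real.exp (-(κ * (n * Real.sqrt n)))) : Summable f := by
  have hs : Summable (fun n : ℕ => 2 * Real.exp (n * -κ)) :=
    (Real.summable_exp_nat_mul_iff.2 (by linarith)).mul_left 2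
  refine hs.of_norm_bounded_eventually_nat ?_
  filter_upwards [h, eventually_ge_atTop 1] with n hn hn1
  rw [Real.norm_of_nonneg (h0 n)]
  refine hn.trans (mul_le_mul_of_nonneg_left (Real.exp_le_exp.2 ?_) (by norm_num))
  have h1 : 1 ≤ Real.sqrt n := Real.one_le_sqrt.2 (by exact_mod_cast hn1)
  have h2 : (n : ℝ) ≤ n * Real.sqrt n := le_mul_of_one_le_right (Nat.cast_nonneg n) h1
  nlinarith

/-- Nearby parameters on the fixed point curve with slightly fewer triangles. -/
lemma exists_nearby_parameters {c ζ x κ τ : ℝ} (hc : 0 < c) (hζ : 0 < ζ) (hζ1 : ζ < 1)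
    (hu : 2 * ζ * c ^ 2 < Real.exp 1) (hx0 : 0 < x) (hx : x = c * Real.exp (-(ζ * x ^ 2)))
    (hκ : 0 < κ) (hτ : 0 < τ) :
    ∃ ζ' y : ℝ, 0 < ζ' ∧ ζ' < 1 ∧ 2 * ζ' * c ^ 2 < Real.exp 1 ∧ 0 < y ∧
      y = c * Real.exp (-(ζ' * y ^ 2)) ∧ |ζ' - ζ| ≤ τ ∧
      (1 - ζ') * y ^ 3 < (1 - ζ) * x ^ 3 ∧
      -Real.log (1 - ζ') * (((1 - ζ) * x ^ 3 - (1 - ζ') * y ^ 3) / 3) ≤ κ := by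
  set g : ℝ → ℝ := fun y => Real.log (c / y) / y ^ 2 with hg
  have hlog : Real.log (c / x) = ζ * x ^ 2 := by
    have h1 : c / x = Real.exp (ζ * x ^ 2) := by
      rw [div_eq_iff hx0.ne']
      nth_rewrite 2 [hx]
      rw [mul_left_comm, ← Real.exp_add, add_neg_cancel, Real.exp_zero, mul_one]
    rw [h1, Real.log_exp]
  have hgx : g x = ζ := by
    simp only [hg]; rw [hlog]; field_simp
  have hgc : Tendsto g (nhds x) (nhds ζ) := by
    rw [← hgx]
    have : ContinuousAt g x := by
      refine ContinuousAt.div (ContinuousAt.log ?_ (by positivity)) (by fun_prop) (by positivity)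
      exact continuousAt_const.div continuousAt_id hx0.ne'
    exact this
  have hprod : Tendsto (fun y => -Real.log (1 - g y) *
      (((1 - ζ) * x ^ 3 - (1 - g y) * y ^ 3) / 3)) (nhds x) (nhds 0) := by
    have h1 : Tendsto (fun y => 1 - g y) (nhds x) (nhds (1 - ζ)) := tendsto_const_nhds.sub hgc
    have h2 := (h1.log (by linarith)).neg
    have h3 := ((tendsto_const_nhds (x := (1 - ζ) * x ^ 3)).sub
      (h1.mul ((continuous_pow 3).tendsto x))).div_const 3
    have h4 := h2.mul h3
    rwa [sub_self, zero_div, mul_zero] at h4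
  have hgu : Tendsto (fun y => 2 * g y * c ^ 2) (nhds x) (nhds (2 * ζ * c ^ 2)) :=
    (hgc.const_mul 2).mul_const _
  have hev := ((((hgc.eventually (gt_mem_nhds hζ1)).and (hgu.eventually (gt_mem_nhds hu))).and
    (hgc.eventually (Metric.closedBall_mem_nhds ζ hτ))).and
    ((hprod.eventually (gt_mem_nhds hκ)).and (lt_mem_nhds hx0))).filter_mono
    (nhdsWithin_le_nhds (s := Set.Iio x))
  obtain ⟨y, ⟨⟨⟨h1, h2⟩, h3⟩, h4, hy0⟩, hyx⟩ := (hev.and self_mem_nhdsWithin).exists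
  have hyx' : y < x := hyx
  have hgy : ζ < g y := by
    rw [← hgx]
    have h5 : Real.log (c / x) < Real.log (c / y) :=
      Real.log_lt_log (by positivity) (div_lt_div_of_pos_left hc hy0 hyx')
    have h6 : 0 < Real.log (c / x) := by rw [hlog]; positivity
    exact div_lt_div₀ h5 (pow_le_pow_left₀ hy0.le hyx'.le 2) (h6.trans h5).le (by positivity)
  refine ⟨g y, y, hζ.trans hgy, h1, h2, hy0, ?_, ?_, ?_, h4.le⟩
  · have h5 : g y * y ^ 2 = Real.log (c / y) := by
      simp only [hg]; field_simp
    rw [h5, Real.exp_neg, Real.exp_log (by positivity)]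
    field_simp
  · rwa [← Real.dist_eq]
  · have h5 : y ^ 3 ≤ x ^ 3 := pow_le_pow_left₀ hy0.le hyx'.le 3
    have h6 : 0 < y ^ 3 := by positivity
    nlinarith

/-- The structure theorem in terms of the fixed point `x` instead of the Lambert function. -/
lemma summable_erCondProb_of_fixedPoint {c η ζ x : ℝ} (hc : 0 < c) (hη : 0 ≤ η) (hζ : 0 < ζ)
    (hζ1 : ζ ≤ 1) (hu : 2 * ζ * c ^ 2 < Real.exp 1) (hx0 : 0 < x)
    (hx : x = c * Real.exp (-(ζ * x ^ 2))) (hηx : η * c ^ 3 = (1 - ζ) * x ^ 3) {p : ℕ → ℝ}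
    (hp : ∀ n, p n ∈ Set.Ioo (0 : ℝ) 1)
    (hpc : Tendsto (fun n : ℕ => Real.sqrt n * p n) atTop (nhds c)) {ε : ℝ} (hε : 0 < ε) :
    Summable (fun n : ℕ => erCondProb n (p n)
      {G | ε * (x / Real.sqrt n) * (n : ℝ) ^ 2 ≤
        cutNorm (adjMat G - Matrix.of (fun _ _ : Fin n => x / Real.sqrt n))}
      {G | (triCount G : ℝ) ≤ η * (n.choose 3 : ℝ) * p n ^ 3}) := by
  obtain ⟨κ, hκ, τ, hτ, hcut⟩ := cutNorm_tail hc hx0 hε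
    (oddsUpper_and_oddsLower hc hζ hζ1 hu hx0 hx (show 0 < ε * x / 4 by positivity)).1
  have hodds := tendsto_sqrt_mul_odds hpc
  have hnear : ∀ τ > 0, ∀ᶠ n : ℕ in atTop, |Real.sqrt n * (p n / (1 - p n)) - c| ≤ τ :=
    fun τ hτ => hodds.eventually (Metric.closedBall_mem_nhds c hτ)
  have hl : ∀ n, 0 ≤ p n / (1 - p n) := fun n =>
    div_nonneg (hp n).1.le (by linarith [(hp n).2])
  rcases hζ1.eq_or_lt with rfl | hζ1
  · have hη0 : η = 0 := by
      rw [sub_self, zero_mul] at hηx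
      exact (mul_eq_zero.1 hηx).resolve_right (by positivity)
    subst hη0
    refine summable_of_le_exp hκ (fun n => erCondProb_nonneg (hp n) _ _) ?_
    filter_upwards [hcut, hnear τ hτ] with n hn hn1
    simp only [zero_mul]
    refine (erCondProb_le_of_hardcore (hp n) (Real.exp_nonneg _)
      (hn _ 1 (hl n) hn1 zero_le_one le_rfl (by simpa using hτ.le))).trans ?_
    linarith [Real.exp_pos (-(κ * (n * Real.sqrt n)))]
  · obtain ⟨ζ', y, hζ'0, hζ'1, hu', hy0, hy, hζζ', hlt, hsmall⟩ :=
      exists_nearby_parameters hc hζ hζ1 hu hx0 hx (half_pos hκ) hτ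
    set D := ((1 - ζ) * x ^ 3 - (1 - ζ') * y ^ 3) / 6 with hD
    have hD0 : 0 < D := by rw [hD]; linarith
    obtain ⟨τ', hτ', hwin⟩ := triCount_window (δ := D / 3) hζ'0 hζ'1 hy0 (by positivity)
      (fun δ hδ => oddsUpper_and_oddsLower hc hζ'0 hζ'1.le hu' hy0 hy hδ)
    have hH := tendsto_threshold η hpc
    rw [hηx] at hH
    refine summable_of_le_exp (half_pos hκ) (fun n => erCondProb_nonneg (hp n) _ _) ?_
    filter_upwards [hcut, hwin, hnear τ hτ, hnear τ' hτ', eventually_gt_atTop 0,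
      hH.eventually (Metric.closedBall_mem_nhds _ (show 0 < D / 3 by positivity))]
      with n hn hwn hn1 hn2 hn0 hHn
    have hR : 0 < (n : ℝ) * Real.sqrt n :=
      mul_pos (by exact_mod_cast hn0) (Real.sqrt_pos.2 (by exact_mod_cast hn0))
    rw [Real.dist_eq, abs_le] at hHn
    obtain ⟨hH1, hH2⟩ := hHn
    rw [neg_le_sub_iff_le_add, ← sub_le_iff_le_add, le_div_iff₀ hR] at hH1
    rw [sub_le_iff_le_add, div_le_iff₀ hR] at hH2
    set H := η * (n.choose 3 : ℝ) * p n ^ 3 with hHdef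
    set R := (n : ℝ) * Real.sqrt n with hRdef
    have hexp : 1 - Real.exp (-(-Real.log (1 - ζ'))) = ζ' := by
      rw [neg_neg, Real.exp_log (by linarith)]; ring
    have hDx : (1 - ζ) * x ^ 3 / 6 = (1 - ζ') * y ^ 3 / 6 + D := by rw [hD]; ring
    rw [hDx] at hH1 hH2
    have hL : 0 ≤ -Real.log (1 - ζ') :=
      neg_nonneg.2 (Real.log_nonpos (by linarith) (by linarith))
    have hA := hn (p n / (1 - p n)) ζ' (hl n) hn1 hζ'0.le hζ'1.le hζζ'
    have hw := hwn (p n / (1 - p n)) (hl n) hn2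
    have hDR : 0 < D * R := by positivity
    refine (erCondProb_le_of_window (L := -Real.log (1 - ζ')) (w := 2 * D * R)
      (a := (1 - ζ') * y ^ 3 / 6 * R) (δ := D / 3 * R) (hp n)
      (Real.exp_nonneg (-(κ * R))) hL ?_ ?_ ?_ ?_).trans ?_
    · linarith
    · linarith
    · rw [hexp]; exact hA
    · rw [hexp]; exact hw
    · refine mul_le_mul_of_nonneg_left ?_ (by norm_num)
      rw [← Real.exp_add]
      refine Real.exp_le_exp.2 ?_
      have h1 : -Real.log (1 - ζ') * (2 * D) ≤ κ / 2 := by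
        refine le_trans (le_of_eq ?_) hsmall
        rw [hD]; ring
      have h2 := mul_le_mul_of_nonneg_right h1 hR.le
      linarith

lemma IsLambertW.div_eq {W : ℝ → ℝ} (hW : IsLambertW W) {u : ℝ} (hu : 0 < u) :
    W u / u = Real.exp (-W u) := by
  have h := (hW u hu.le).2.1
  rw [div_eq_iff hu.ne', ← h, h, Real.exp_neg, eq_comm, inv_mul_eq_iff_eq_mul₀ (Real.exp_ne_zero _),
    mul_comm, h]

lemma IsLambertW.mono {W : ℝ → ℝ} (hW : IsLambertW W) {u v : ℝ} (hu : 0 ≤ u) (huv : u ≤ v) :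
    W u ≤ W v := by
  obtain ⟨hu0, hu1, -⟩ := hW u hu
  obtain ⟨hv0, hv1, -⟩ := hW v (hu.trans huv)
  by_contra! h
  have h1 : W v * Real.exp (W v) < W u * Real.exp (W u) :=
    mul_lt_mul h (Real.exp_le_exp.2 h.le) (Real.exp_pos _) hu0
  linarith

/-- Below the critical value of `c`, the fixed point equation is in the uniqueness regime. -/
lemma lt_exp_one_of_ltCbar {W : ℝ → ℝ} (hW : IsLambertW W) {c η ζ : ℝ} (hc : 0 < c)
    (hcbar : LtCbar W c η) (hζ : 0 < ζ) (hζ1 : ζ ≤ 1)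
    (hη : η = (1 - ζ) * (W (2 * ζ * c ^ 2) / (2 * ζ * c ^ 2)) ^ ((3 : ℝ) / 2)) :
    2 * ζ * c ^ 2 < Real.exp 1 := by
  have he := Real.add_one_le_exp (1 : ℝ)
  have he0 := Real.exp_pos 1
  have h_two_div : 2 / Real.exp 1 < Real.exp 1 := by
    rw [div_lt_iff₀ he0]; nlinarith
  by_contra! hu
  have hu2 : 2 / Real.exp 1 ≤ 2 * ζ * c ^ 2 := h_two_div.le.trans hu
  have hu0 : 0 < 2 / Real.exp 1 := by positivity
  have hs : (W (2 * ζ * c ^ 2) / (2 * ζ * c ^ 2)) ^ ((3 : ℝ) / 2) ≤ etaStar W := by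
    rw [etaStar, hW.div_eq (hu0.trans_le hu2), hW.div_eq hu0]
    refine Real.rpow_le_rpow (Real.exp_nonneg _) (Real.exp_le_exp.2 ?_) (by norm_num)
    linarith [hW.mono hu0.le hu2]
  have hpos : 0 < etaStar W := by
    rw [etaStar, hW.div_eq hu0]
    exact Real.rpow_pos_of_pos (Real.exp_pos _) _
  have hle : η ≤ (1 - ζ) * etaStar W := by
    rw [hη]; exact mul_le_mul_of_nonneg_left hs (by linarith)
  have hlt : η < etaStar W := by nlinarith
  have hfrac : ζ ≤ 1 - η / etaStar W := by
    have : η / etaStar W ≤ 1 - ζ := (div_le_iff₀ hpos).2 hle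
    linarith
  have h1 := hcbar hlt
  have h2 : c < 1 / Real.sqrt (Real.exp 1 * ζ) := by
    refine h1.trans_le (one_div_le_one_div_of_le (Real.sqrt_pos.2 (by positivity)) ?_)
    exact Real.sqrt_le_sqrt (mul_le_mul_of_nonneg_left hfrac he0.le)
  rw [lt_div_iff₀ (Real.sqrt_pos.2 (by positivity))] at h2
  have h3 : (c * Real.sqrt (Real.exp 1 * ζ)) ^ 2 < 1 := by
    have : 0 ≤ c * Real.sqrt (Real.exp 1 * ζ) := by positivity
    nlinarith
  rw [mul_pow, Real.sq_sqrt (by positivity)] at h3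
  rw [div_le_iff₀ he0] at hu2
  nlinarith

/-- The fixed point expressed through the Lambert function. -/
lemma IsLambertW.sqrt_div_eq {W : ℝ → ℝ} (hW : IsLambertW W) {c ζ : ℝ} (hc : 0 < c) (hζ : 0 < ζ) :
    Real.sqrt (W (2 * ζ * c ^ 2) / (2 * ζ)) = c * Real.exp (-(W (2 * ζ * c ^ 2) / 2)) := by
  have hu : 0 < 2 * ζ * c ^ 2 := by positivity
  have h := hW.div_eq hu
  rw [Real.sqrt_eq_iff_mul_self_eq_of_pos (by positivity)]
  have h1 : Real.exp (-(W (2 * ζ * c ^ 2) / 2)) * Real.exp (-(W (2 * ζ * c ^ 2) / 2)) =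
      Real.exp (-W (2 * ζ * c ^ 2)) := by
    rw [← Real.exp_add]; ring_nf
  rw [mul_mul_mul_comm, h1, ← h]
  field_simp

/-- **Theorem (structure of the lower-tail conditional distribution: convergence in cut
norm).** The conditional probabilities that `‖A_G − q·J‖_□ ≥ ε·q·n²` form a convergent
series (Borel–Cantelli). -/
theorem lower_tail_cut_norm_structure
    (W : ℝ → ℝ) (hW : IsLambertW W)
    (c η : ℝ) (hc : 0 < c) (hη : η ∈ Set.Ico (0 : ℝ) 1) (hcbar : LtCbar W c η)
    (zeta : ℝ) (hzeta : zeta ∈ Set.Icc (0 : ℝ) 1) (hzetaEq : zetaLHS W c zeta = η)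
    (p : ℕ → ℝ) (hp : ∀ n, p n ∈ Set.Ioo (0 : ℝ) 1)
    (hpc : Tendsto (fun n : ℕ => Real.sqrt n * p n) atTop (nhds c))
    (ε : ℝ) (hε : 0 < ε) :
    Summable (fun n : ℕ =>
      erCondProb n (p n)
        {G | ε * (Real.sqrt (W (2 * zeta * c ^ 2) / (2 * zeta)) / Real.sqrt n) * (n : ℝ) ^ 2 ≤
          cutNorm (adjMat G -
            Matrix.of (fun _ _ : Fin n =>
              Real.sqrt (W (2 * zeta * c ^ 2) / (2 * zeta)) / Real.sqrt n))}
        {G | (triCount G : ℝ) ≤ η * (n.choose 3 : ℝ) * p n ^ 3}) := by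
  have hz0 : 0 < zeta := by
    refine lt_of_le_of_ne hzeta.1 fun h => ?_
    rw [zetaLHS, ← h, if_pos rfl] at hzetaEq
    linarith [hη.2]
  rw [zetaLHS, if_neg hz0.ne'] at hzetaEq
  have hu : 0 < 2 * zeta * c ^ 2 := by positivity
  have hx := hW.sqrt_div_eq hc hz0
  set x := Real.sqrt (W (2 * zeta * c ^ 2) / (2 * zeta)) with hxdef
  have hx0 : 0 < x := by rw [hx]; positivity
  have hxsq : zeta * x ^ 2 = W (2 * zeta * c ^ 2) / 2 := by
    rw [hxdef, Real.sq_sqrt (div_nonneg (hW _ hu.le).1 (by positivity))]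
    field_simp
  refine summable_erCondProb_of_fixedPoint hc hη.1 hz0 hzeta.2
    (lt_exp_one_of_ltCbar hW hc hcbar hz0 hzeta.2 hzetaEq.symm) hx0 (by rw [hxsq]; exact hx) ?_ hp
    hpc hε
  rw [← hzetaEq, hW.div_eq hu, hx, mul_pow, ← Real.exp_nat_mul, ← Real.exp_mul]
  push_cast
  ring_nf
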